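/- arXiv:2603.25554 — 2 statements merged into one kernel-verified Lean document; each statement's English description precedes it below -/
import Mathlib

section
/- Let Q be a finite, connected, acyclic quiver and α, β two dimension vectors of Q. Then (α∘β)_Q ≠ 0 if and only if ⟨α,β⟩ = 0 and there exist representations V and W of Q of dimension vectors α and β, respectively, with Hom_Q(V,W) = 0. -/
/-- A finite quiver: finite sets of vertices and arrows with tail and head maps. -/
structure FinQuiver where
  V : Type
  A : Type
  [instFinV : Fintype V]
  [instDecV : DecidableEq V]
  [instFinA : Fintype A]
  [instDecA : DecidableEq A]
  t : A → V
  h : A → V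

attribute [instance] FinQuiver.instFinV FinQuiver.instDecV FinQuiver.instFinA FinQuiver.instDecA

/-- Coerce an `ℕ`-valued function (dimension vector) to a `ℤ`-valued one. -/
def natToInt {X : Type} (α : X → ℕ) : X → ℤ := fun x => (α x : ℤ)

namespace FinQuiver

variable (Q : FinQuiver)

/-- `Q` has an oriented cycle. -/
def HasCycle : Prop :=
  ∃ k : ℕ, ∃ c : Fin (k + 1) → Q.A, ∀ i : Fin (k + 1), Q.h (c i) = Q.t (c (i + 1))

/-- `Q` is acyclic: it has no oriented cycles. -/
def Acyclic : Prop := ¬ Q.HasCycle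

/-- Two vertices are adjacent if some arrow joins them (in either direction). -/
def Adj (u v : Q.V) : Prop :=
  ∃ a : Q.A, (Q.t a = u ∧ Q.h a = v) ∨ (Q.t a = v ∧ Q.h a = u)

/-- `Q` is connected as an undirected graph. -/
def Connected : Prop := ∀ u v : Q.V, Relation.ReflTransGen Q.Adj u v

/-- The representation space `rep(Q, β)`. -/
def Rep (β : Q.V → ℕ) : Type :=
  ∀ a : Q.A, Matrix (Fin (β (Q.h a))) (Fin (β (Q.t a))) ℂ

/-- The group `GL(β) = ∏ₓ GL(β(x), ℂ)`. -/
def GLb (β : Q.V → ℕ) : Type :=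
  ∀ x : Q.V, (Matrix (Fin (β x)) (Fin (β x)) ℂ)ˣ

/-- The action of `g⁻¹ ∈ GL(β)` on `W ∈ rep(Q,β)`: `(g⁻¹ · W)ₐ = g_{ha}⁻¹ Wₐ g_{ta}`. -/
noncomputable def invAct {β : Q.V → ℕ} (g : Q.GLb β) (W : Q.Rep β) : Q.Rep β :=
  fun a => ((g (Q.h a))⁻¹).val * W a * (g (Q.t a)).val

/-- `f : rep(Q,β) → ℂ` is a polynomial function of the matrix entries. -/
def IsPolyFun {β : Q.V → ℕ} (f : Q.Rep β → ℂ) : Prop :=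
  ∃ P : MvPolynomial ((a : Q.A) × (Fin (β (Q.h a)) × Fin (β (Q.t a)))) ℂ,
    ∀ W : Q.Rep β, f W = MvPolynomial.eval (fun i => W i.1 i.2.1 i.2.2) P

/-- The character `∏ₓ det(gₓ)^{σ(x)}` of `GL(β)` attached to an integral weight `σ`. -/
noncomputable def detWeight {β : Q.V → ℕ} (σ : Q.V → ℤ) (g : Q.GLb β) : ℂ :=
  ∏ x : Q.V, (Matrix.det (g x).val) ^ (σ x)

/-- The space `SI(Q,β)_σ` of semi-invariants of weight `σ`: polynomial functions `f` on
`rep(Q,β)` with `f(g⁻¹ · W) = (∏ₓ det(gₓ)^{σ(x)}) f(W)` for all `g ∈ GL(β)`. -/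
noncomputable def SIw (β : Q.V → ℕ) (σ : Q.V → ℤ) : Submodule ℂ (Q.Rep β → ℂ) where
  carrier := {f | Q.IsPolyFun f ∧
    ∀ (g : Q.GLb β) (W : Q.Rep β), f (Q.invAct g W) = Q.detWeight σ g * f W}
  add_mem' := by
    rintro f₁ f₂ ⟨⟨P₁, hP₁⟩, h₁⟩ ⟨⟨P₂, hP₂⟩, h₂⟩
    refine ⟨⟨P₁ + P₂, fun W => ?_⟩, fun g W => ?_⟩
    · simp [Pi.add_apply, hP₁ W, hP₂ W]
    · simp only [Pi.add_apply, h₁ g W, h₂ g W]; ring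
  zero_mem' := by
    refine ⟨⟨0, fun W => ?_⟩, fun g W => ?_⟩ <;> simp
  smul_mem' := by
    rintro c f ⟨⟨P, hP⟩, hf⟩
    refine ⟨⟨MvPolynomial.C c * P, fun W => ?_⟩, fun g W => ?_⟩
    · simp [Pi.smul_apply, hP W, smul_eq_mul]
    · simp only [Pi.smul_apply, hf g W, smul_eq_mul]; ring

/-- The dimension of the weight space of semi-invariants `SI(Q,β)_σ`. -/
noncomputable def siDim (β : Q.V → ℕ) (σ : Q.V → ℤ) : ℕ :=
  Module.finrank ℂ (Q.SIw β σ)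

/-- The Euler (Ringel) form of `Q`. -/
def euler (α γ : Q.V → ℤ) : ℤ :=
  (∑ x : Q.V, α x * γ x) - ∑ a : Q.A, α (Q.t a) * γ (Q.h a)

/-- The weight `⟨α, ·⟩ : x ↦ ⟨α, eₓ⟩` attached to a dimension vector `α`. -/
def weightOf (α : Q.V → ℕ) : Q.V → ℤ :=
  fun x => (α x : ℤ) - ∑ a : Q.A, (if Q.h a = x then (α (Q.t a) : ℤ) else 0)

/-- `(α ∘ β)_Q := dim SI(Q,β)_{⟨α,·⟩}`. -/
noncomputable def circ (α β : Q.V → ℕ) : ℕ := Q.siDim β (Q.weightOf α)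

/-- `φ` is a morphism of representations `V → W`. -/
def IsHom {α γ : Q.V → ℕ} (V : Q.Rep α) (W : Q.Rep γ)
    (φ : ∀ x : Q.V, Matrix (Fin (γ x)) (Fin (α x)) ℂ) : Prop :=
  ∀ a : Q.A, φ (Q.h a) * V a = W a * φ (Q.t a)

/-- The space `Hom_Q(V, W)` of morphisms of representations. -/
noncomputable def homSpace {α γ : Q.V → ℕ} (V : Q.Rep α) (W : Q.Rep γ) :
    Submodule ℂ (∀ x : Q.V, Matrix (Fin (γ x)) (Fin (α x)) ℂ) where
  carrier := {φ | Q.IsHom V W φ}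
  add_mem' := by
    intro φ ψ hφ hψ a
    simp only [Pi.add_apply, Matrix.add_mul, Matrix.mul_add, hφ a, hψ a]
  zero_mem' := by
    intro a
    simp
  smul_mem' := by
    intro c φ hφ a
    simp only [Pi.smul_apply, Matrix.smul_mul, Matrix.mul_smul, hφ a]

/-- A representation is Schur if its endomorphism algebra is one-dimensional. -/
def IsSchur {α : Q.V → ℕ} (V : Q.Rep α) : Prop :=
  Module.finrank ℂ (Q.homSpace V V) = 1

/-- A quiver exceptional sequence of dimension vectors. -/
def IsExcSeq {Nn : ℕ} (ε : Fin Nn → (Q.V → ℕ)) : Prop :=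
  (∀ i, Q.euler (natToInt (ε i)) (natToInt (ε i)) = 1 ∧ ∃ V : Q.Rep (ε i), Q.IsSchur V) ∧
  ∀ i j : Fin Nn, i < j →
    Q.euler (natToInt (ε i)) (natToInt (ε j)) ≤ 0 ∧ Q.circ (ε j) (ε i) ≠ 0

/-- The quiver `Q(ℰ)` attached to a sequence `ℰ = (ε₁,…,ε_N)` of dimension vectors:
vertices `1,…,N` and `−⟨εᵢ, εⱼ⟩` arrows from `i` to `j` for `i ≠ j`. -/
def quiverOfSeq {Nn : ℕ} (ε : Fin Nn → (Q.V → ℕ)) : FinQuiver where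
  V := Fin Nn
  A := (i : Fin Nn) × (j : Fin Nn) ×
        Fin (if i = j then 0 else (-(Q.euler (natToInt (ε i)) (natToInt (ε j)))).toNat)
  t := fun a => a.1
  h := fun a => a.2.1

end FinQuiver

/-- An isomorphism of quivers. -/
structure QuiverIso (Q₁ Q₂ : FinQuiver) where
  vEquiv : Q₁.V ≃ Q₂.V
  aEquiv : Q₁.A ≃ Q₂.A
  t_comm : ∀ a : Q₁.A, Q₂.t (aEquiv a) = vEquiv (Q₁.t a)
  h_comm : ∀ a : Q₁.A, Q₂.h (aEquiv a) = vEquiv (Q₁.h a)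

/-- The `p`-complete bipartite quiver `Q^p_{m,n}`: sources `x₁,…,x_m`, sinks `y₁,…,y_n`,
and `p` arrows from each `xᵢ` to each `yⱼ`. -/
def Qpmn (m n p : ℕ) : FinQuiver where
  V := Fin m ⊕ Fin n
  A := Fin m × Fin n × Fin p
  t := fun a => Sum.inl a.1
  h := fun a => Sum.inr a.2.1

/-- The number `T_{a,b}` of 3-way contingency tables of size `m × n × p` with the two
plane-sum margins fixed by `a` and `b`. -/
noncomputable def numTables (m n p : ℕ) (a : Fin m → ℕ) (b : Fin n → ℕ) : ℕ :=
  Nat.card {x : Fin m × Fin n × Fin p → ℕ //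
    (∀ i : Fin m, ∑ j : Fin n, ∑ k : Fin p, x (i, j, k) = a i) ∧
    (∀ j : Fin n, ∑ i : Fin m, ∑ k : Fin p, x (i, j, k) = b j)}

/-- The weight `θ_{a,b}` of `Q^p_{m,n}`. -/
def thetaAB {m n : ℕ} (a : Fin m → ℕ) (b : Fin n → ℕ) : Fin m ⊕ Fin n → ℤ :=
  Sum.elim (fun i => (a i : ℤ)) (fun j => -(b j : ℤ))

namespace QSI
open MvPolynomial

/-- generic matrix with entries prescribed variables -/
noncomputable def genMat {τ : Type} {n : ℕ} (ι : Fin n → Fin n → τ) :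
    Matrix (Fin n) (Fin n) (MvPolynomial τ ℂ) := Matrix.of fun i j => X (ι i j)

lemma eval_genMat {τ : Type} {n : ℕ} (ι : Fin n → Fin n → τ) (x : τ → ℂ) :
    eval x (genMat ι).det = Matrix.det (Matrix.of fun i j => x (ι i j)) := by
  rw [RingHom.map_det]
  congr 1
  ext i j
  simp [genMat]

lemma genMat_expand {τ : Type} (n : ℕ) (ι : Fin (n+1) → Fin (n+1) → τ) :
    (genMat ι).det = (genMat (fun i j : Fin n => ι i.succ j.succ)).det * X (ι 0 0) +
      ∑ j : Fin n, (-1) ^ ((j.succ : Fin (n+1)) : ℕ) * X (ι 0 j.succ) *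
        (genMat (fun i k : Fin n => ι i.succ (Fin.succAbove j.succ k))).det := by
  rw [Matrix.det_succ_row_zero, Fin.sum_univ_succ, Fin.val_zero, pow_zero, one_mul,
    Fin.succAbove_zero, mul_comm (genMat ι 0 0)]
  rfl

lemma genMat_irreducible {τ : Type} (n : ℕ) (ι : Fin (n+1) → Fin (n+1) → τ)
    (hι : Function.Injective (fun p : Fin (n+1) × Fin (n+1) => ι p.1 p.2)) :
    Irreducible (genMat ι).det := by
  classical
  induction n with
  | zero =>
    have : (genMat ι).det = 1 * X (ι 0 0) + 0 := by simp [genMat]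
    rw [this]
    apply irreducible_mul_X_add
    · exact one_ne_zero
    · simp
    · simp
    · exact isRelPrime_one_left
  | succ n ih =>
    have hdet := genMat_expand _ ι
    obtain ⟨m, hm⟩ : ∃ m, m = (genMat (fun i j : Fin (n+1) => ι i.succ j.succ)).det := ⟨_, rfl⟩
    obtain ⟨g, hg⟩ : ∃ g, g = ∑ j : Fin (n+1), (-1) ^ ((j.succ : Fin (n+2)) : ℕ) * X (ι 0 j.succ) *
        (genMat (fun i k : Fin (n+1) => ι i.succ (Fin.succAbove j.succ k))).det := ⟨_, rfl⟩
    rw [← hm, ← hg] at hdet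
    have hirr : Irreducible m := by
      rw [hm]
      apply ih
      rintro ⟨a, b⟩ ⟨c, d⟩ h
      have := @hι (a.succ, b.succ) (c.succ, d.succ) h
      simpa using this
    have hsupp : ∀ {k : ℕ} (κ : Fin k → Fin k → τ), (∀ i j, κ i j ≠ ι 0 0) →
        (genMat κ).det ∈ supported ℂ {t | t ≠ ι 0 0} := by
      intro k κ hκ
      rw [Matrix.det_apply]
      refine sum_mem fun σ _ => ?_
      rw [Units.smul_def, zsmul_eq_mul]
      refine mul_mem (intCast_mem _ _) (prod_mem fun i _ => ?_)
      simp only [genMat, Matrix.of_apply]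
      exact X_mem_supported.2 (hκ _ _)
    have hne : ∀ i j, i ≠ 0 ∨ j ≠ 0 → ι i j ≠ ι 0 0 := by
      intro i j hij h
      have := @hι (i, j) (0, 0) h
      simp at this
      tauto
    have key : ∀ p ∈ supported ℂ {t | t ≠ ι 0 0}, ι 0 0 ∉ p.vars := by
      intro p hp h
      have := mem_supported.1 hp h
      simp at this
    rw [hdet]
    apply irreducible_mul_X_add _ _ _ hirr.ne_zero
    · rw [hm]
      exact key _ (hsupp _ fun i j => hne _ _ (Or.inl (Fin.succ_ne_zero _)))
    · apply key
      rw [hg]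
      refine sum_mem fun j _ => mul_mem (mul_mem ?_ ?_) ?_
      · exact pow_mem (neg_mem (one_mem _)) _
      · exact X_mem_supported.2 (hne _ _ (Or.inr (Fin.succ_ne_zero _)))
      · exact hsupp (fun i k => ι i.succ (Fin.succAbove j.succ k))
          fun i j => hne _ _ (Or.inl (Fin.succ_ne_zero _))
    · refine (hirr.isRelPrime_iff_not_dvd).2 ?_
      intro hdvd
      obtain ⟨x, hx⟩ : ∃ x : τ → ℂ, ∀ i j, x (ι i j) =
          (Equiv.Perm.permMatrix ℂ (Equiv.swap (0 : Fin (n+2)) 1)) i j := by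
        refine ⟨Function.extend (fun p : Fin (n+2) × Fin (n+2) => ι p.1 p.2)
          (fun p => (Equiv.Perm.permMatrix ℂ (Equiv.swap (0 : Fin (n+2)) 1)) p.1 p.2) 0, ?_⟩
        intro i j
        exact hι.extend_apply _ _ (i, j)
      have e1 : eval x m = 0 := by
        rw [hm, eval_genMat]
        apply Matrix.det_eq_zero_of_row_eq_zero 0
        intro j
        simp only [Matrix.of_apply, hx]
        simp [Equiv.Perm.permMatrix, PEquiv.toMatrix_apply]
        exact (Fin.succ_ne_zero _).symm
      have e2 : eval x (genMat ι).det ≠ 0 := by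
        rw [eval_genMat]
        have : (Matrix.of fun i j => x (ι i j)) =
          (Equiv.Perm.permMatrix ℂ (Equiv.swap (0 : Fin (n+2)) 1)) := by
          ext i j; simp only [Matrix.of_apply, hx]
        rw [this, Matrix.det_permutation]
        simp
      obtain ⟨c, hc⟩ := hdvd
      apply e2
      rw [hdet, hc]
      simp [e1]

/-- A polynomial vanishing wherever a generic determinant vanishes is divisible by it. -/
lemma genMat_dvd {τ : Type} [Finite τ] (n : ℕ) (ι : Fin n → Fin n → τ)
    (hι : Function.Injective (fun p : Fin n × Fin n => ι p.1 p.2)) (G : MvPolynomial τ ℂ)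
    (hG : ∀ x : τ → ℂ, eval x (genMat ι).det = 0 → eval x G = 0) : (genMat ι).det ∣ G := by
  cases n with
  | zero => simp [genMat]
  | succ n =>
    have hp : Prime (genMat ι).det := (genMat_irreducible n ι hι).prime
    have hI : (Ideal.span {(genMat ι).det}).IsPrime := (Ideal.span_singleton_prime hp.ne_zero).2 hp
    have := IsPrime.vanishingIdeal_zeroLocus (K := ℂ) (Ideal.span {(genMat ι).det})
    rw [← Ideal.mem_span_singleton, ← this]
    intro x hx
    have h1 := hx _ (Ideal.mem_span_singleton_self _)
    rw [MvPolynomial.aeval_eq_eval] at h1 ⊢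
    exact hG x h1

end QSI

namespace QSI
open MvPolynomial

/-- the all-ones exponent -/
noncomputable def ones (R : Type) [Fintype R] : R →₀ ℕ := Finsupp.equivFunOnFinite.symm fun _ => 1

/-- a linear form as a polynomial -/
noncomputable def lin {R : Type} [Fintype R] (l : R → ℂ) : MvPolynomial R ℂ :=
  ∑ r, C (l r) * X r

lemma eval_lin {R : Type} [Fintype R] (l u : R → ℂ) : eval u (lin l) = ∑ r, l r * u r := by
  simp [lin]

lemma sum_single_eq_ones_iff {R K : Type} [Fintype R] [DecidableEq R] [Fintype K] (p : K → R) :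
    (∑ k, Finsupp.single (p k) 1 = ones R) ↔ Function.Bijective p := by
  classical
  rw [Function.bijective_iff_existsUnique, DFunLike.ext_iff]
  refine forall_congr' fun r => ?_
  have : (∑ k, Finsupp.single (p k) 1) r = (Finset.univ.filter fun k => p k = r).card := by
    simp [Finsupp.finsetSum_apply, Finsupp.single_apply]
  rw [this]
  simp only [ones, Finsupp.equivFunOnFinite_symm_apply_apply]
  rw [Finset.card_eq_one]
  constructor
  · rintro ⟨a, ha⟩
    have h1 : ∀ k, p k = r ↔ k = a := by
      intro k
      have := Finset.ext_iff.1 ha k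
      simpa using this
    exact ⟨a, (h1 a).2 rfl, fun y hy => (h1 y).1 hy⟩
  · rintro ⟨a, ha, hu⟩
    refine ⟨a, ?_⟩
    ext k
    simp only [Finset.mem_filter, Finset.mem_univ, true_and, Finset.mem_singleton]
    exact ⟨fun h => hu k h, fun h => h ▸ ha⟩

lemma coeff_prod_lin {R K : Type} [Fintype R] [DecidableEq R] [Fintype K] [DecidableEq K]
    (l : K → R → ℂ) :
    coeff (ones R) (∏ k, lin (l k)) = ∑ ρ : K ≃ R, ∏ k, l k (ρ k) := by
  classical
  unfold lin
  rw [Finset.prod_univ_sum, coeff_sum]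
  have h1 : ∀ p : K → R, coeff (ones R) (∏ k, (C (l k (p k)) * X (p k) : MvPolynomial R ℂ)) =
      if Function.Bijective p then ∏ k, l k (p k) else 0 := by
    intro p
    have : (∏ k, (C (l k (p k)) * X (p k) : MvPolynomial R ℂ)) =
        monomial (∑ k, Finsupp.single (p k) 1) (∏ k, l k (p k)) := by
      rw [monomial_sum_index]
      rw [Finset.prod_mul_distrib, map_prod]
      rfl
    rw [this, coeff_monomial]
    simp only [sum_single_eq_ones_iff]
  rw [Finset.sum_congr rfl fun p _ => h1 p, ← Finset.sum_filter]
  symm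
  refine Finset.sum_bij (fun (ρ : K ≃ R) _ => (ρ : K → R)) ?_ ?_ ?_ ?_
  · intro ρ _
    simp
  · intro a _ b _ h
    exact DFunLike.coe_injective h
  · intro p hp
    simp only [Finset.mem_filter] at hp
    exact ⟨Equiv.ofBijective p hp.2, Finset.mem_univ _, rfl⟩
  · intro ρ _
    rfl

lemma polar {R T₁ T₂ : Type} [Fintype R] [DecidableEq R] (s₁ : Finset T₁) (s₂ : Finset T₂)
    (K₁ : T₁ → Type) [∀ τ, Fintype (K₁ τ)] [∀ τ, DecidableEq (K₁ τ)]
    (K₂ : T₂ → Type) [∀ τ, Fintype (K₂ τ)] [∀ τ, DecidableEq (K₂ τ)]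
    (c₁ : T₁ → ℂ) (c₂ : T₂ → ℂ) (l₁ : ∀ τ, K₁ τ → R → ℂ) (l₂ : ∀ τ, K₂ τ → R → ℂ)
    (h : ∀ u : R → ℂ, ∑ τ ∈ s₁, c₁ τ * ∏ k, ∑ r, l₁ τ k r * u r =
      ∑ τ ∈ s₂, c₂ τ * ∏ k, ∑ r, l₂ τ k r * u r) :
    ∑ τ ∈ s₁, c₁ τ * ∑ ρ : K₁ τ ≃ R, ∏ k, l₁ τ k (ρ k) =
      ∑ τ ∈ s₂, c₂ τ * ∑ ρ : K₂ τ ≃ R, ∏ k, l₂ τ k (ρ k) := by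
  have : (∑ τ ∈ s₁, C (c₁ τ) * ∏ k, lin (l₁ τ k) : MvPolynomial R ℂ) =
      ∑ τ ∈ s₂, C (c₂ τ) * ∏ k, lin (l₂ τ k) := by
    apply MvPolynomial.funext
    intro u
    simpa [eval_lin, map_sum, map_mul, map_prod] using h u
  have h2 := congrArg (coeff (ones R)) this
  simpa only [coeff_sum, coeff_C_mul, coeff_prod_lin] using h2

lemma mixed_det {K R C' : Type} [Fintype K] [DecidableEq K] [Fintype R] [DecidableEq R] [Fintype C']
    [DecidableEq C'] (e : C' ≃ R) (M : K → R → C' → ℂ)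
    (h : ∀ z : K → ℂ, Matrix.det (Matrix.of fun c c' => ∑ k, M k (e c) c' * z k) = 0)
    (ρ : K ≃ R) (γ : K ≃ C') :
    ∑ ω : Equiv.Perm R, ∑ ω' : Equiv.Perm C', ((Equiv.Perm.sign ω : ℤ) : ℂ) *
      ((Equiv.Perm.sign ω' : ℤ) : ℂ) * ∏ k, M k (ω (ρ k)) (ω' (γ k)) = 0 := by
  have h1 := polar (R := K) (T₁ := Equiv.Perm C') (T₂ := Empty) Finset.univ ∅ (fun _ => C')
    (fun _ => C') (fun π => ((Equiv.Perm.sign π : ℤ) : ℂ)) (fun _ => 0)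
    (fun π c k => M k (e (π c)) c) (fun _ _ _ => 0) (by
      intro z
      have := h z
      rw [Matrix.det_apply'] at this
      simpa using this)
  rw [Finset.sum_empty] at h1
  -- reindex
  set κ : Equiv.Perm C' := (γ.symm.trans ρ).trans e.symm with hκ
  have h2 : ∑ ω' : Equiv.Perm C', ∑ ω : Equiv.Perm R, ((Equiv.Perm.sign ω : ℤ) : ℂ) *
      ((Equiv.Perm.sign ω' : ℤ) : ℂ) * ∏ k, M k (ω (ρ k)) (ω' (γ k)) =
      ((Equiv.Perm.sign κ : ℤ) : ℂ) * ∑ θ : C' ≃ K, ∑ π : Equiv.Perm C',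
        ((Equiv.Perm.sign π : ℤ) : ℂ) * ∏ c, M (θ c) (e (π c)) c := by
    rw [Finset.mul_sum]
    let E1 : Equiv.Perm C' ≃ (C' ≃ K) :=
      { toFun := fun ω' => (γ.trans ω').symm
        invFun := fun θ => (γ.symm.trans θ.symm)
        left_inv := fun ω' => by ext; simp
        right_inv := fun θ => by ext; simp }
    refine Fintype.sum_equiv E1 _ _ fun ω' => ?_
    rw [Finset.mul_sum]
    let E2 : Equiv.Perm R ≃ Equiv.Perm C' :=
      { toFun := fun ω => (e.symm.permCongr ω) * κ * ω'⁻¹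
        invFun := fun π => e.permCongr (π * ω' * κ⁻¹)
        left_inv := fun ω => by ext; simp
        right_inv := fun π => by ext; simp }
    refine Fintype.sum_equiv E2 _ _ fun ω => ?_
    have hs : ((Equiv.Perm.sign (E2 ω) : ℤ) : ℂ) = ((Equiv.Perm.sign ω : ℤ) : ℂ) *
      ((Equiv.Perm.sign κ : ℤ) : ℂ) * ((Equiv.Perm.sign ω' : ℤ) : ℂ) := by
      simp only [E2, Equiv.coe_fn_mk, Equiv.Perm.sign_mul, Equiv.Perm.sign_permCongr,
        Equiv.Perm.sign_inv]
      push_cast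
      ring
    have hk2 : ((Equiv.Perm.sign κ : ℤ) : ℂ) * ((Equiv.Perm.sign κ : ℤ) : ℂ) = 1 := by
      rcases Int.units_eq_one_or (Equiv.Perm.sign κ) with h | h <;> simp [h]
    have hp : ∏ c, M (E1 ω' c) (e (E2 ω c)) c = ∏ k, M k (ω (ρ k)) (ω' (γ k)) := by
      symm
      refine Fintype.prod_equiv (γ.trans ω') _ _ fun k => ?_
      simp [E1, E2, hκ]
    rw [hs, hp]
    linear_combination (-(((Equiv.Perm.sign ω : ℤ) : ℂ) *
      ((Equiv.Perm.sign ω' : ℤ) : ℂ) * ∏ k, M k (ω (ρ k)) (ω' (γ k)))) * hk2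
  rw [Finset.sum_comm, h2, Finset.sum_comm]
  simp only [← Finset.mul_sum]
  rw [h1, mul_zero]

lemma omega_pos {R I B : Type} [Fintype R] [DecidableEq R] [Fintype I] [DecidableEq I]
    [DecidableEq B] (ri : R → I) (rb : R → B)
    (hR : ∀ r r', ri r = ri r' → rb r = rb r' → r = r') :
    ∑ ω : Equiv.Perm R, ((Equiv.Perm.sign ω : ℤ) : ℂ) * ∑ ω' : Equiv.Perm R,
      ((Equiv.Perm.sign ω' : ℤ) : ℂ) * ∑ θ : R ≃ R, ∏ r,
        (if rb (ω' r) = rb r ∧ ri (θ r) = ri r ∧ rb (ω (θ r)) = rb (θ r) ∧ ri (ω (θ r)) = ri (ω' r)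
          then (1 : ℂ) else 0) ≠ 0 := by
  classical
  let s : Equiv.Perm R → ℤ := fun ω => if ∀ r, rb (ω r) = rb r then (Equiv.Perm.sign ω : ℤ) else 0
  let v : Equiv.Perm R → R → I × I := fun ω r => (ri r, ri (ω r))
  let c : ℤ := ∑ ω, ∑ ω', ∑ θ : Equiv.Perm R, s ω * s ω' * (if v ω ∘ θ = v ω' then 1 else 0)
  have hc : ∑ ω : Equiv.Perm R, ((Equiv.Perm.sign ω : ℤ) : ℂ) * ∑ ω' : Equiv.Perm R,
      ((Equiv.Perm.sign ω' : ℤ) : ℂ) * ∑ θ : R ≃ R, ∏ r,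
        (if rb (ω' r) = rb r ∧ ri (θ r) = ri r ∧ rb (ω (θ r)) = rb (θ r) ∧ ri (ω (θ r)) = ri (ω' r)
          then (1 : ℂ) else 0) = (c : ℂ) := by
    simp only [c]
    push_cast
    refine Finset.sum_congr rfl fun ω _ => ?_
    rw [Finset.mul_sum]
    refine Finset.sum_congr rfl fun ω' _ => ?_
    rw [← mul_assoc, Finset.mul_sum]
    refine Finset.sum_congr rfl fun θ _ => ?_
    rw [Finset.prod_ite_zero]
    simp only [Finset.prod_const_one, Finset.mem_univ, true_implies]
    by_cases h1 : ∀ r, rb (ω r) = rb r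
    · by_cases h2 : ∀ r, rb (ω' r) = rb r
      · simp only [s, if_pos h1, if_pos h2]
        congr 1
        have : (∀ i, rb (ω' i) = rb i ∧ ri (θ i) = ri i ∧ rb (ω (θ i)) = rb (θ i) ∧
            ri (ω (θ i)) = ri (ω' i)) ↔ v ω ∘ θ = v ω' := by
          rw [funext_iff]
          refine forall_congr' fun r => ?_
          simp [v, h1, h2]
        simp [this]
      · have : ¬ (∀ i, rb (ω' i) = rb i ∧ ri (θ i) = ri i ∧ rb (ω (θ i)) = rb (θ i) ∧
            ri (ω (θ i)) = ri (ω' i)) := fun h => h2 fun r => (h r).1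
        simp [s, this, h2]
    · have : ¬ (∀ i, rb (ω' i) = rb i ∧ ri (θ i) = ri i ∧ rb (ω (θ i)) = rb (θ i) ∧
            ri (ω (θ i)) = ri (ω' i)) := fun h => h1 fun r => by
              have := (h (θ.symm r)).2.2.1
              simpa using this
      simp [s, this, h1]
  rw [hc]
  let T : (R → I × I) → ℤ := fun w => ∑ ω, ∑ θ : Equiv.Perm R, s ω * (if v ω ∘ θ = w then 1 else 0)
  have hT : ∑ w, T w * T w = (Fintype.card (Equiv.Perm R)) * c := by
    have e1 : ∀ w, T w * T w = ∑ ω, ∑ ω', ∑ η : Equiv.Perm R, ∑ θ : Equiv.Perm R,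
        s ω * s ω' * (if v ω ∘ θ = w then (if v ω' ∘ η = w then 1 else 0) else 0) := by
      intro w
      simp only [T]
      rw [Finset.sum_mul_sum]
      refine Finset.sum_congr rfl fun ω _ => Finset.sum_congr rfl fun ω' _ => ?_
      rw [Finset.sum_mul_sum, Finset.sum_comm]
      refine Finset.sum_congr rfl fun η _ => Finset.sum_congr rfl fun θ _ => ?_
      split_ifs <;> ring
    rw [Finset.sum_congr rfl fun w _ => e1 w, Finset.sum_comm, Finset.mul_sum]
    refine Finset.sum_congr rfl fun ω _ => ?_
    rw [Finset.sum_comm, Finset.mul_sum]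
    refine Finset.sum_congr rfl fun ω' _ => ?_
    rw [Finset.sum_comm]
    have e2 : ∀ η : Equiv.Perm R, ∑ w, ∑ θ : Equiv.Perm R,
        s ω * s ω' * (if v ω ∘ θ = w then (if v ω' ∘ η = w then (1 : ℤ) else 0) else 0) =
        ∑ θ : Equiv.Perm R, s ω * s ω' * (if v ω ∘ θ = v ω' then 1 else 0) := by
      intro η
      rw [Finset.sum_comm]
      refine Fintype.sum_equiv (Equiv.mulRight η⁻¹) _ _ fun θ => ?_
      rw [← Finset.mul_sum]
      congr 1
      rw [Finset.sum_ite_eq]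
      simp only [Finset.mem_univ, if_true, Equiv.coe_mulRight]
      congr 1
      apply propext
      constructor
      · intro h
        funext r
        have := congrFun h (η⁻¹ r)
        simpa using this.symm
      · intro h
        funext r
        have := congrFun h (η r)
        simpa using this.symm
    rw [Finset.sum_congr rfl fun η _ => e2 η]
    simp
  have hpos : 0 < ∑ w, T w * T w := by
    refine Finset.sum_pos' (fun w _ => mul_self_nonneg _) ⟨v 1, Finset.mem_univ _, ?_⟩
    apply mul_self_pos.2
    have : T (v 1) = ∑ θ : Equiv.Perm R, (if v 1 ∘ θ = v 1 then 1 else 0) := by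
      simp only [T]
      rw [Finset.sum_eq_single 1]
      · simp [s]
      · intro ω _ hω
        refine Finset.sum_eq_zero fun θ _ => ?_
        by_cases h1 : ∀ r, rb (ω r) = rb r
        · rw [if_neg, mul_zero]
          intro h
          apply hω
          ext r
          have := congrFun h (θ.symm r)
          simp only [v, Function.comp, Equiv.apply_symm_apply, Equiv.Perm.coe_one, id,
            Prod.mk.injEq] at this
          exact hR _ _ (this.2.trans this.1.symm) (h1 r)
        · simp [s, h1]
      · simp
    rw [this]
    apply ne_of_gt
    refine Finset.sum_pos' (fun θ _ => by split_ifs <;> simp) ⟨1, Finset.mem_univ _, by simp⟩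
  intro h0
  have : c = 0 := by exact_mod_cast h0
  rw [hT, this] at hpos
  simp at hpos

end QSI

namespace QSI
open MvPolynomial

lemma eval_as_sigma {σ : Type} [Fintype σ] (F : MvPolynomial σ ℂ) (x : σ → ℂ) :
    eval x F = ∑ m ∈ F.support, coeff m F * ∏ k : (Σ v : σ, Fin (m v)), x k.1 := by
  rw [eval_eq']
  refine Finset.sum_congr rfl fun m _ => ?_
  congr 1
  rw [Fintype.prod_sigma]
  simp

lemma polar2 {τ R C' : Type} [Fintype τ] [DecidableEq τ] [Fintype R] [DecidableEq R] [Fintype C']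
    [DecidableEq C'] (F : MvPolynomial τ ℂ) (l : τ → R → C' → ℂ) (D : R → R → R → ℂ)
    (E : C' → C' → C' → ℂ) (κ : ℂ)
    (h : ∀ (u : R → ℂ) (v : C' → ℂ), eval (fun x => ∑ r, (∑ c, l x r c * v c) * u r) F =
      Matrix.det (Matrix.of fun r' r => ∑ s, D r' r s * u s) *
      Matrix.det (Matrix.of fun r' r => ∑ s, E r' r s * v s) * κ) :
    ∑ m ∈ F.support, coeff m F * ∑ ρ : (Σ x : τ, Fin (m x)) ≃ R,
      ∑ γ : (Σ x : τ, Fin (m x)) ≃ C', ∏ k, l k.1 (ρ k) (γ k) =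
    (∑ π : Equiv.Perm R, ((Equiv.Perm.sign π : ℤ) : ℂ) * ∑ θ : R ≃ R, ∏ r, D (π r) r (θ r)) *
    (∑ π : Equiv.Perm C', ((Equiv.Perm.sign π : ℤ) : ℂ) * ∑ θ : C' ≃ C', ∏ r, E (π r) r (θ r))
      * κ := by
  obtain ⟨cD, hcD⟩ : ∃ cD, cD = (∑ π : Equiv.Perm R, ((Equiv.Perm.sign π : ℤ) : ℂ) *
    ∑ θ : R ≃ R, ∏ r, D (π r) r (θ r)) := ⟨_, rfl⟩
  rw [← hcD]
  have s1 : ∀ v : C' → ℂ, ∑ m ∈ F.support, coeff m F * ∑ ρ : (Σ x : τ, Fin (m x)) ≃ R,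
      ∏ k, ∑ c, l k.1 (ρ k) c * v c =
      cD * (Matrix.det (Matrix.of fun r' r => ∑ s, E r' r s * v s) * κ) := by
    intro v
    have := polar (R := R) (T₁ := τ →₀ ℕ) (T₂ := Equiv.Perm R) F.support Finset.univ
      (fun m => (Σ x : τ, Fin (m x)))
      (fun _ => R) (fun m => coeff m F) (fun π => ((Equiv.Perm.sign π : ℤ) : ℂ) *
        (Matrix.det (Matrix.of fun r' r => ∑ s, E r' r s * v s) * κ))
      (fun m k r => ∑ c, l k.1 r c * v c)
      (fun π r s => D (π r) r s) (by
        intro u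
        have := h u v
        rw [eval_as_sigma] at this
        rw [this, Matrix.det_apply', mul_assoc, Finset.sum_mul]
        refine Finset.sum_congr rfl fun π _ => ?_
        simp only [Matrix.of_apply]
        ring)
    rw [this, hcD, Finset.sum_mul]
    refine Finset.sum_congr rfl fun π _ => ?_
    ring
  have := polar (R := C') (T₁ := Σ m : τ →₀ ℕ, ((Σ x : τ, Fin (m x)) ≃ R))
      (T₂ := Equiv.Perm C') (F.support.sigma fun m => (Finset.univ :
        Finset ((Σ x : τ, Fin (m x)) ≃ R))) (Finset.univ : Finset (Equiv.Perm C'))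
        (fun m => (Σ x : τ, Fin (m.1 x)))
      (fun _ => C') (fun m => coeff m.1 F)
        (fun π => ((Equiv.Perm.sign π : ℤ) : ℂ) * (cD * κ))
      (fun m k c => l k.1 (m.2 k) c) (fun π r s => E (π r) r s) (by
        intro v
        rw [Finset.sum_sigma]
        simp only [← Finset.mul_sum]
        rw [s1 v, Matrix.det_apply', Finset.sum_mul (a := κ), Finset.mul_sum]
        refine Finset.sum_congr rfl fun π _ => ?_
        simp only [Matrix.of_apply]
        ring)
  rw [Finset.sum_sigma] at this
  simp only [← Finset.mul_sum] at this
  rw [this, Finset.mul_sum, Finset.sum_mul]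
  refine Finset.sum_congr rfl fun π _ => ?_
  ring

lemma sum_five {S1 S2 M : Type} (s : Finset M) [Fintype S1] [Fintype S2] (K1 K2 : M → Type)
    [∀ m, Fintype (K1 m)] [∀ m, Fintype (K2 m)] (sg : S1 → S2 → ℂ) (c : M → ℂ)
    (f : ∀ m, K1 m → K2 m → S1 → S2 → ℂ)
    (h : ∀ m ∈ s, ∀ ρ γ, ∑ a, ∑ b, sg a b * f m ρ γ a b = 0) :
    ∑ a, ∑ b, sg a b * (∑ m ∈ s, c m * ∑ ρ, ∑ γ, f m ρ γ a b) = 0 := by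
  have : ∀ p : S1 × S2, sg p.1 p.2 * (∑ m ∈ s, c m * ∑ ρ, ∑ γ, f m ρ γ p.1 p.2) =
      ∑ m ∈ s, c m * ∑ q : K1 m × K2 m, sg p.1 p.2 * f m q.1 q.2 p.1 p.2 := by
    intro p
    rw [Finset.mul_sum]
    refine Finset.sum_congr rfl fun m _ => ?_
    rw [Fintype.sum_prod_type]
    simp only [Finset.mul_sum]
    refine Finset.sum_congr rfl fun _ _ => Finset.sum_congr rfl fun _ _ => ?_
    ring
  rw [← Fintype.sum_prod_type' (f := fun a b => sg a b * (∑ m ∈ s, c m * ∑ ρ, ∑ γ, f m ρ γ a b)),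
    Finset.sum_congr rfl fun p _ => this p, Finset.sum_comm]
  refine Finset.sum_eq_zero fun m hm => ?_
  rw [← Finset.mul_sum, Finset.sum_comm, Finset.sum_eq_zero, mul_zero]
  intro q _
  rw [Fintype.sum_prod_type]
  exact h m hm q.1 q.2

theorem fft {A I B B' R C' : Type} [Fintype A] [DecidableEq A] [Fintype I] [DecidableEq I]
    [DecidableEq B] [DecidableEq B'] [Fintype R] [DecidableEq R] [Fintype C'] [DecidableEq C']
    (ri : R → I) (rb : R → B) (hR : ∀ r r', ri r = ri r' → rb r = rb r' → r = r')
    (ci : C' → I) (cb : C' → B') (hC : ∀ r r', ci r = ci r' → cb r = cb r' → r = r')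
    (e : C' ≃ R) (F : MvPolynomial (A × I × I) ℂ) (W : A × I × I → ℂ)
    (hF : ∀ (ω : Equiv.Perm R) (ω' : Equiv.Perm C') (u : R → ℂ) (v : C' → ℂ),
      eval (fun x : A × I × I => ∑ r, (∑ c, (if ri r = x.2.1 ∧ rb (ω r) = rb r then 1 else 0) *
        (if ci c = x.2.2 ∧ cb (ω' c) = cb c then 1 else 0) * W (x.1, ri (ω r), ci (ω' c)) * v c)
          * u r) F =
      Matrix.det (Matrix.of fun r' r => ∑ s, (if rb r' = rb r ∧ ri s = ri r ∧ rb (ω s) = rb s ∧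
        ri (ω s) = ri r' then 1 else 0) * u s) *
      Matrix.det (Matrix.of fun c' c => ∑ s, (if cb c' = cb c ∧ ci s = ci c ∧ cb (ω' s) = cb s ∧
        ci (ω' s) = ci c' then 1 else 0) * v s) * eval W F)
    (hW : eval W F ≠ 0) :
    ∃ Z : A → B → B' → ℂ,
      (∀ a b b', Z a b b' ≠ 0 → ∃ r c, rb r = b ∧ cb c = b' ∧ (a, ri r, ci c) ∈ F.vars) ∧
      Matrix.det (Matrix.of fun c c' => ∑ a, Z a (rb (e c)) (cb c') * W (a, ri (e c), ci c')) ≠ 0 := by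
  classical
  by_contra hcon
  push Not at hcon
  let cR : Equiv.Perm R → ℂ := fun ω => ∑ π : Equiv.Perm R, ((Equiv.Perm.sign π : ℤ) : ℂ) *
     ∑ θ : R ≃ R, ∏ r,
        (if rb (π r) = rb r ∧ ri (θ r) = ri r ∧ rb (ω (θ r)) = rb (θ r) ∧ ri (ω (θ r)) = ri (π r)
          then (1 : ℂ) else 0)
  let cC : Equiv.Perm C' → ℂ := fun ω => ∑ π : Equiv.Perm C', ((Equiv.Perm.sign π : ℤ) : ℂ) *
     ∑ θ : C' ≃ C', ∏ r,
        (if cb (π r) = cb r ∧ ci (θ r) = ci r ∧ cb (ω (θ r)) = cb (θ r) ∧ ci (ω (θ r)) = ci (π r)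
          then (1 : ℂ) else 0)
  have s2 : ∀ (ω : Equiv.Perm R) (ω' : Equiv.Perm C'),
      ∑ m ∈ F.support, coeff m F * ∑ ρ : (Σ x : A × I × I, Fin (m x)) ≃ R,
        ∑ γ : (Σ x : A × I × I, Fin (m x)) ≃ C', ∏ k,
        ((if ri (ρ k) = k.1.2.1 ∧ rb (ω (ρ k)) = rb (ρ k) then 1 else 0) *
        (if ci (γ k) = k.1.2.2 ∧ cb (ω' (γ k)) = cb (γ k) then 1 else 0) *
          W (k.1.1, ri (ω (ρ k)), ci (ω' (γ k)))) = cR ω * cC ω' * eval W F := by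
    intro ω ω'
    exact polar2 F (fun x r c => (if ri r = x.2.1 ∧ rb (ω r) = rb r then 1 else 0) *
        (if ci c = x.2.2 ∧ cb (ω' c) = cb c then 1 else 0) * W (x.1, ri (ω r), ci (ω' c)))
      (fun r' r s => if rb r' = rb r ∧ ri s = ri r ∧ rb (ω s) = rb s ∧
        ri (ω s) = ri r' then 1 else 0)
      (fun c' c s => if cb c' = cb c ∧ ci s = ci c ∧ cb (ω' s) = cb s ∧
        ci (ω' s) = ci c' then 1 else 0) (eval W F) (hF ω ω')
  have hcR : ∑ ω, ((Equiv.Perm.sign ω : ℤ) : ℂ) * cR ω ≠ 0 := omega_pos ri rb hR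
  have hcC : ∑ ω, ((Equiv.Perm.sign ω : ℤ) : ℂ) * cC ω ≠ 0 := omega_pos ci cb hC
  have s3 : ∑ ω : Equiv.Perm R, ∑ ω' : Equiv.Perm C', ((Equiv.Perm.sign ω : ℤ) : ℂ) *
      ((Equiv.Perm.sign ω' : ℤ) : ℂ) * (cR ω * cC ω' * eval W F) ≠ 0 := by
    have : ∑ ω : Equiv.Perm R, ∑ ω' : Equiv.Perm C', ((Equiv.Perm.sign ω : ℤ) : ℂ) *
      ((Equiv.Perm.sign ω' : ℤ) : ℂ) * (cR ω * cC ω' * eval W F) =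
      (∑ ω, ((Equiv.Perm.sign ω : ℤ) : ℂ) * cR ω) * (∑ ω, ((Equiv.Perm.sign ω : ℤ) : ℂ) * cC ω) *
        eval W F := by
      rw [Finset.sum_mul_sum, Finset.sum_mul]
      refine Finset.sum_congr rfl fun ω _ => ?_
      rw [Finset.sum_mul]
      refine Finset.sum_congr rfl fun ω' _ => ?_
      ring
    rw [this]
    exact mul_ne_zero (mul_ne_zero hcR hcC) hW
  apply s3
  have s4 : ∀ m ∈ F.support, ∀ (ρ : (Σ x : A × I × I, Fin (m x)) ≃ R)
      (γ : (Σ x : A × I × I, Fin (m x)) ≃ C'),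
      ∑ ω : Equiv.Perm R, ∑ ω' : Equiv.Perm C', ((Equiv.Perm.sign ω : ℤ) : ℂ) *
      ((Equiv.Perm.sign ω' : ℤ) : ℂ) * ∏ k,
        ((if ri (ρ k) = k.1.2.1 ∧ rb (ω (ρ k)) = rb (ρ k) then 1 else 0) *
        (if ci (γ k) = k.1.2.2 ∧ cb (ω' (γ k)) = cb (γ k) then 1 else 0) *
          W (k.1.1, ri (ω (ρ k)), ci (ω' (γ k)))) = 0 := by
    intro m hm ρ γ
    by_cases hk : ∀ k, ri (ρ k) = k.1.2.1 ∧ ci (γ k) = k.1.2.2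
    · have := mixed_det e (fun k r c => (if rb r = rb (ρ k) then 1 else 0) *
        (if cb c = cb (γ k) then 1 else 0) * W (k.1.1, ri r, ci c)) (by
          intro z
          have h1 := hcon (fun a b b' => ∑ k, (if k.1.1 = a ∧ b = rb (ρ k) ∧ b' = cb (γ k)
            then z k else 0)) (by
              intro a b b' h
              obtain ⟨k, _, hk'⟩ := Finset.exists_ne_zero_of_sum_ne_zero h
              simp only [ne_eq, ite_eq_right_iff, Classical.not_imp] at hk'
              obtain ⟨⟨h1, h2, h3⟩, _⟩ := hk'
              refine ⟨ρ k, γ k, h2.symm, h3.symm, ?_⟩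
              rw [(hk k).1, (hk k).2, ← h1]
              rw [mem_vars_iff_mem_support]
              refine ⟨m, hm, ?_⟩
              simp only [Prod.mk.eta, Finsupp.mem_support_iff]
              have := k.2.2
              omega)
          convert h1 using 2
          ext c c'
          simp only [Matrix.of_apply, Finset.sum_mul]
          rw [Finset.sum_comm]
          refine Finset.sum_congr rfl fun k _ => ?_
          rw [Finset.sum_eq_single k.1.1]
          · by_cases hb : rb (e c) = rb (ρ k) <;> by_cases hc : cb c' = cb (γ k) <;>
              simp [hb, hc, mul_comm]
          · intro a _ ha
            simp [Ne.symm ha]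
          · simp) ρ γ
      refine Eq.trans ?_ this
      refine Finset.sum_congr rfl fun ω _ => Finset.sum_congr rfl fun ω' _ => ?_
      congr 1
      refine Finset.prod_congr rfl fun k _ => ?_
      simp only [(hk k).1, (hk k).2, true_and]
    · push Not at hk
      obtain ⟨k, hk⟩ := hk
      refine Finset.sum_eq_zero fun ω _ => Finset.sum_eq_zero fun ω' _ => ?_
      rw [Finset.prod_eq_zero (Finset.mem_univ k), mul_zero]
      by_cases h : ri (ρ k) = k.1.2.1
      · simp [hk h]
      · simp [h]
  rw [Finset.sum_congr rfl fun ω _ => Finset.sum_congr rfl fun ω' _ => by rw [← s2 ω ω']]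
  exact sum_five F.support (fun m => (Σ x : A × I × I, Fin (m x)) ≃ R)
    (fun m => (Σ x : A × I × I, Fin (m x)) ≃ C')
    (fun (ω : Equiv.Perm R) (ω' : Equiv.Perm C') => ((Equiv.Perm.sign ω : ℤ) : ℂ) *
      ((Equiv.Perm.sign ω' : ℤ) : ℂ)) (fun m => coeff m F)
    (fun m ρ γ ω ω' => ∏ k,
        ((if ri (ρ k) = k.1.2.1 ∧ rb (ω (ρ k)) = rb (ρ k) then 1 else 0) *
        (if ci (γ k) = k.1.2.2 ∧ cb (ω' (γ k)) = cb (γ k) then 1 else 0) *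
          W (k.1.1, ri (ω (ρ k)), ci (ω' (γ k))))) s4

end QSI

namespace QSI
open MvPolynomial

/-- the arrow relation -/
def arel (Q : FinQuiver) (x y : Q.V) : Prop := ∃ a, Q.t a = x ∧ Q.h a = y

lemma path_of_transGen (Q : FinQuiver) {x y : Q.V} (h : Relation.TransGen (arel Q) x y) :
    ∃ (k : ℕ) (c : ℕ → Q.A), Q.t (c 0) = x ∧ Q.h (c k) = y ∧
      ∀ i < k, Q.h (c i) = Q.t (c (i+1)) := by
  induction h with
  | single h =>
    obtain ⟨a, h1, h2⟩ := h
    exact ⟨0, fun _ => a, h1, h2, by simp⟩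
  | tail _ h ih =>
    obtain ⟨a, h1, h2⟩ := h
    obtain ⟨k, c, e1, e2, e3⟩ := ih
    refine ⟨k+1, fun i => if i ≤ k then c i else a, by simpa using e1, by simpa using h2, ?_⟩
    intro i hi
    by_cases h : i < k
    · have h' : i + 1 ≤ k := h
      simp only [h.le, h', if_true]
      exact e3 i h
    · have : i = k := by omega
      subst this
      simp [e2, h1]

lemma irrefl_of_acyclic (Q : FinQuiver) (hQ : Q.Acyclic) (x : Q.V) :
    ¬ Relation.TransGen (arel Q) x x := by
  intro h
  obtain ⟨k, c, e1, e2, e3⟩ := path_of_transGen Q h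
  apply hQ
  refine ⟨k, fun i => c i, fun i => ?_⟩
  by_cases hi : (i : ℕ) < k
  · rw [e3 i hi]
    congr 2
    rw [Fin.val_add_one_of_lt]
    exact Fin.lt_def.2 (by simpa using hi)
  · have : i = Fin.last k := by
      ext
      have := i.2
      simp
      omega
    subst this
    simp [e1, e2]

lemma exists_rank (Q : FinQuiver) (hQ : Q.Acyclic) :
    ∃ n : Q.V → ℕ, ∀ a, n (Q.t a) < n (Q.h a) := by
  classical
  refine ⟨fun x => (Finset.univ.filter fun y => Relation.TransGen (arel Q) y x).card, fun a => ?_⟩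
  apply Finset.card_lt_card
  rw [Finset.ssubset_iff_of_subset]
  · refine ⟨Q.t a, ?_, ?_⟩
    · simpa using Relation.TransGen.single ⟨a, rfl, rfl⟩
    · simpa using irrefl_of_acyclic Q hQ _
  · intro y hy
    simp only [Finset.mem_filter, Finset.mem_univ, true_and] at hy ⊢
    exact hy.tail ⟨a, rfl, rfl⟩

lemma scal {σ : Type} [Fintype σ] (P : MvPolynomial σ ℂ) (lam : σ → ℂ) (κ : ℂ)
    (h : ∀ x, eval (fun v => lam v * x v) P = κ * eval x P) :
    ∀ m ∈ P.support, ∏ v, lam v ^ m v = κ := by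
  classical
  intro m hm
  have : (∑ m ∈ P.support, monomial m (coeff m P * ∏ v, lam v ^ m v)) = C κ * P := by
    apply MvPolynomial.funext
    intro x
    rw [map_mul, eval_C, ← h x, map_sum, eval_eq']
    refine Finset.sum_congr rfl fun m _ => ?_
    rw [eval_monomial, Finsupp.prod_fintype _ _ (by simp)]
    simp only [mul_pow, Finset.prod_mul_distrib]
    ring
  have h2 := congrArg (coeff m) this
  simp only [coeff_sum, coeff_monomial, coeff_C_mul, Finset.sum_ite_eq', hm, if_true] at h2
  rw [mem_support_iff] at hm
  have h3 : coeff m P * (∏ v, lam v ^ m v - κ) = 0 := by linear_combination h2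
  rcases mul_eq_zero.1 h3 with h | h
  · exact absurd h hm
  · linear_combination h

/-- one-parameter decomposition -/
noncomputable def pw {σ : Type} [Fintype σ] (w : σ → ℕ) (P : MvPolynomial σ ℂ) (x : σ → ℂ) :
    Polynomial ℂ :=
  ∑ m ∈ P.support, Polynomial.C (coeff m P * ∏ v, x v ^ m v) * Polynomial.X ^ (∑ v, w v * m v)

lemma eval_pw {σ : Type} [Fintype σ] (w : σ → ℕ) (P : MvPolynomial σ ℂ) (x : σ → ℂ) (s : ℂ) :
    (pw w P x).eval s = eval (fun v => s ^ w v * x v) P := by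
  rw [pw, Polynomial.eval_finsetSum, eval_eq']
  refine Finset.sum_congr rfl fun m _ => ?_
  simp only [Polynomial.eval_mul, Polynomial.eval_C, Polynomial.eval_pow, Polynomial.eval_X,
    mul_pow, Finset.prod_mul_distrib, ← pow_mul, Finset.prod_pow_eq_pow_sum]
  ring

lemma coeff_pw_zero {σ : Type} [Fintype σ] (w : σ → ℕ) (P : MvPolynomial σ ℂ) (e : ℕ)
    (h : ∀ x, (pw w P x).coeff e = 0) : ∀ m ∈ P.support, ∑ v, w v * m v ≠ e := by
  classical
  intro m hm he
  have : (∑ m ∈ P.support, if ∑ v, w v * m v = e then monomial m (coeff m P) else 0) = 0 := by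
    apply MvPolynomial.funext
    intro x
    rw [map_zero, ← h x, pw, Polynomial.finsetSum_coeff, map_sum]
    refine Finset.sum_congr rfl fun m _ => ?_
    rw [Polynomial.coeff_C_mul_X_pow]
    simp only [eq_comm (a := e)]
    split_ifs
    · rw [eval_monomial, Finsupp.prod_fintype _ _ (by simp)]
    · simp
  have h2 := congrArg (coeff m) this
  rw [coeff_sum, Finset.sum_eq_single m] at h2
  · rw [if_pos he, coeff_monomial, if_pos rfl] at h2
    exact (mem_support_iff.1 hm) (by simpa using h2)
  · intro b _ hb
    split_ifs
    · rw [coeff_monomial, if_neg hb]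
    · simp
  · intro h; exact absurd hm h

lemma natDegree_pw {σ : Type} [Fintype σ] (w : σ → ℕ) (P : MvPolynomial σ ℂ) (x : σ → ℂ) (K : ℕ)
    (h : ∀ m ∈ P.support, ∑ v, w v * m v ≤ K) : (pw w P x).natDegree ≤ K := by
  refine Polynomial.natDegree_sum_le_of_forall_le _ _ fun m hm => ?_
  exact (Polynomial.natDegree_C_mul_X_pow_le _ _).trans (h m hm)

end QSI

namespace QSI
open MvPolynomial

/-- coordinates of the representation space -/
abbrev Co (Q : FinQuiver) (β : Q.V → ℕ) : Type :=
  (a : Q.A) × (Fin (β (Q.h a)) × Fin (β (Q.t a)))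

/-- basis vectors of all vertices -/
abbrev Ix (Q : FinQuiver) (β : Q.V → ℕ) : Type := (x : Q.V) × Fin (β x)

variable {Q : FinQuiver} {β : Q.V → ℕ}

/-- row index -/
def rI (v : Co Q β) : Ix Q β := ⟨Q.h v.1, v.2.1⟩
/-- column index -/
def cI (v : Co Q β) : Ix Q β := ⟨Q.t v.1, v.2.2⟩

/-- representation with given coordinates -/
def toRep (x : Co Q β → ℂ) : Q.Rep β := fun a => Matrix.of fun p q => x ⟨a, p, q⟩

/-- coordinates of a representation -/
def ofRep (W : Q.Rep β) : Co Q β → ℂ := fun v => W v.1 v.2.1 v.2.2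

lemma ofRep_toRep (x : Co Q β → ℂ) : ofRep (toRep x) = x := rfl

lemma toRep_ofRep (W : Q.Rep β) : toRep (ofRep W) = W := rfl

/-- semi-invariance of a polynomial -/
def SemiInv (P : MvPolynomial (Co Q β) ℂ) (σ : Q.V → ℤ) : Prop :=
  ∀ (g : Q.GLb β) (W : Q.Rep β), eval (ofRep (Q.invAct g W)) P = Q.detWeight σ g * eval (ofRep W) P

/-- row degree -/
def rowdeg (m : Co Q β →₀ ℕ) (i : Ix Q β) : ℕ := ∑ v, if rI v = i then m v else 0
/-- column degree -/
def coldeg (m : Co Q β →₀ ℕ) (i : Ix Q β) : ℕ := ∑ v, if cI v = i then m v else 0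

/-- invertible diagonal matrix -/
noncomputable def diagU {n : ℕ} (d : Fin n → ℂ) (hd : ∀ i, d i ≠ 0) :
    (Matrix (Fin n) (Fin n) ℂ)ˣ where
  val := Matrix.diagonal d
  inv := Matrix.diagonal fun i => (d i)⁻¹
  val_inv := by
    rw [Matrix.diagonal_mul_diagonal]
    simp [hd]
  inv_val := by
    rw [Matrix.diagonal_mul_diagonal]
    simp [hd]

lemma torus_scal {P : MvPolynomial (Co Q β) ℂ} {σ : Q.V → ℤ} (hP : SemiInv P σ)
    (d : Ix Q β → ℂ) (hd : ∀ i, d i ≠ 0) : ∀ m ∈ P.support,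
    ∏ v, ((d (rI v))⁻¹ * d (cI v)) ^ m v = ∏ x, (∏ i, d ⟨x, i⟩) ^ σ x := by
  apply scal
  intro x
  have := hP (fun y => diagU (fun i => d ⟨y, i⟩) fun i => hd _) (toRep x)
  rw [ofRep_toRep] at this
  have h2 : Q.detWeight σ (fun y => diagU (fun i => d ⟨y, i⟩) fun i => hd _) =
      ∏ x, (∏ i : Fin (β x), d ⟨x, i⟩) ^ σ x := by
    simp only [FinQuiver.detWeight]
    refine Finset.prod_congr rfl fun x _ => ?_
    simp [diagU, Matrix.det_diagonal]
  rw [h2] at this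
  rw [← this]
  congr 1
  congr 1
  funext v
  have h3 : ofRep (Q.invAct (fun y => diagU (fun i => d ⟨y, i⟩) fun i => hd _) (toRep x)) v =
    (Matrix.diagonal (fun i => (d ⟨Q.h v.1, i⟩)⁻¹) * (toRep x v.1) *
      Matrix.diagonal (fun i => d ⟨Q.t v.1, i⟩)) v.2.1 v.2.2 := rfl
  rw [h3, Matrix.mul_diagonal, Matrix.diagonal_mul]
  simp only [rI, cI, toRep, Matrix.of_apply]
  ring

lemma torus {P : MvPolynomial (Co Q β) ℂ} {σ : Q.V → ℤ} (hP : SemiInv P σ) :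
    ∀ m ∈ P.support, ∀ i : Ix Q β, (coldeg m i : ℤ) = rowdeg m i + σ i.1 := by
  intro m hm i
  have h := torus_scal hP (fun j => if j = i then 2 else 1) (by intro j; split_ifs <;> simp) m hm
  have h1 : ∏ v : Co Q β, (((if rI v = i then (2:ℂ) else 1))⁻¹ * (if cI v = i then 2 else 1)) ^ m v =
      (2 : ℂ) ^ ((coldeg m i : ℤ) - rowdeg m i) := by
    have e1 : ∀ v : Co Q β, (((if rI v = i then (2:ℂ) else 1))⁻¹ * (if cI v = i then 2 else 1)) ^ m v =
      ((2 : ℂ) ^ (if rI v = i then m v else 0))⁻¹ * 2 ^ (if cI v = i then m v else 0) := by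
      intro v
      rw [mul_pow]
      split_ifs <;> simp
    rw [Finset.prod_congr rfl fun v _ => e1 v, Finset.prod_mul_distrib, Finset.prod_inv_distrib,
      Finset.prod_pow_eq_pow_sum, Finset.prod_pow_eq_pow_sum, zpow_sub₀ (by norm_num), zpow_natCast,
      zpow_natCast, div_eq_inv_mul]
    rfl
  have h2 : ∏ x, (∏ j : Fin (β x), if (⟨x, j⟩ : Ix Q β) = i then (2:ℂ) else 1) ^ σ x = 2 ^ σ i.1 := by
    rw [Finset.prod_eq_single i.1]
    · congr 1
      rw [Finset.prod_eq_single i.2]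
      · simp
      · intro j _ hj
        rw [if_neg]
        intro h
        apply hj
        obtain ⟨x, k⟩ := i
        simpa using h
      · simp
    · intro x _ hx
      rw [Finset.prod_eq_one, one_zpow]
      intro j _
      rw [if_neg]
      rintro rfl
      exact hx rfl
    · simp
  rw [h1, h2] at h
  have h4 := congrArg (fun z : ℂ => ‖z‖) h
  simp only [norm_zpow, Complex.norm_ofNat] at h4
  have := zpow_right_injective₀ (a := (2:ℝ)) (by norm_num) (by norm_num) h4
  linarith

lemma sum_coldeg (m : Co Q β →₀ ℕ) (c : Ix Q β → ℤ) :
    ∑ i, c i * (coldeg m i : ℤ) = ∑ v, c (cI v) * m v := by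
  simp only [coldeg]
  push_cast
  simp only [Finset.mul_sum]
  rw [Finset.sum_comm]
  refine Finset.sum_congr rfl fun v _ => ?_
  simp

lemma sum_rowdeg (m : Co Q β →₀ ℕ) (c : Ix Q β → ℤ) :
    ∑ i, c i * (rowdeg m i : ℤ) = ∑ v, c (rI v) * m v := by
  simp only [rowdeg]
  push_cast
  simp only [Finset.mul_sum]
  rw [Finset.sum_comm]
  refine Finset.sum_congr rfl fun v _ => ?_
  simp

lemma sum_weight {P : MvPolynomial (Co Q β) ℂ} {σ : Q.V → ℤ} (hP : SemiInv P σ) (h0 : P ≠ 0) :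
    ∑ x, σ x * β x = 0 := by
  obtain ⟨m, hm⟩ := support_nonempty.2 h0
  have h1 := sum_coldeg m (fun _ => 1)
  have h2 := sum_rowdeg m (fun _ => 1)
  have h3 : ∑ i : Ix Q β, (1:ℤ) * (coldeg m i : ℤ) = ∑ i : Ix Q β, (1 * (rowdeg m i : ℤ) + σ i.1) := by
    refine Finset.sum_congr rfl fun i _ => ?_
    rw [torus hP m hm i]
    ring
  rw [Finset.sum_add_distrib, h2, h1] at h3
  have h6 : ∑ i : Ix Q β, σ i.1 = ∑ x, (β x : ℤ) * σ x := by
    rw [Fintype.sum_sigma]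
    simp
  have h5 : ∑ x, σ x * β x = ∑ x, (β x : ℤ) * σ x :=
    Finset.sum_congr rfl fun x _ => mul_comm (σ x) (β x : ℤ)
  rw [h5]
  linarith

lemma degree_bound (n : Q.V → ℕ) (hn : ∀ a, n (Q.t a) < n (Q.h a)) (σ : Q.V → ℤ)
    {P : MvPolynomial (Co Q β) ℂ} (hP : SemiInv P σ) :
    P.totalDegree ≤ (- ∑ i : Ix Q β, (n i.1 : ℤ) * σ i.1).toNat := by
  rw [totalDegree]
  refine Finset.sup_le fun m hm => ?_
  rw [Finsupp.sum_fintype _ _ (by simp)]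
  have h1 := sum_coldeg m (fun i => n i.1)
  have h2 := sum_rowdeg m (fun i => n i.1)
  have h3 : ∑ i : Ix Q β, (n i.1 : ℤ) * (coldeg m i : ℤ) =
      ∑ i : Ix Q β, ((n i.1 : ℤ) * (rowdeg m i : ℤ) + n i.1 * σ i.1) := by
    refine Finset.sum_congr rfl fun i _ => ?_
    rw [torus hP m hm i]
    ring
  rw [Finset.sum_add_distrib, h2, h1] at h3
  have h4 : ((∑ v, m v : ℕ) : ℤ) ≤ ∑ v : Co Q β, (n (rI v).1 : ℤ) * m v - ∑ v : Co Q β, (n (cI v).1 : ℤ) * m v := by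
    rw [← Finset.sum_sub_distrib]
    push_cast
    refine Finset.sum_le_sum fun v _ => ?_
    have : (n (cI v).1 : ℤ) + 1 ≤ n (rI v).1 := by exact_mod_cast hn v.1
    have h5 : (0:ℤ) ≤ m v := by positivity
    nlinarith
  have : ((∑ v, m v : ℕ) : ℤ) ≤ (- ∑ i : Ix Q β, (n i.1 : ℤ) * σ i.1) := by linarith
  omega

end QSI

namespace QSI
open MvPolynomial
variable {Q : FinQuiver} {β : Q.V → ℕ}

lemma finite_SIw (hQ : Q.Acyclic) (σ : Q.V → ℤ) : Module.Finite ℂ (Q.SIw β σ) := by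
  obtain ⟨n, hn⟩ := exists_rank Q hQ
  let D := (- ∑ i : Ix Q β, (n i.1 : ℤ) * σ i.1).toNat
  let E : MvPolynomial (Co Q β) ℂ →ₗ[ℂ] (Q.Rep β → ℂ) :=
    { toFun := fun P W => eval (ofRep W) P
      map_add' := fun P P' => by funext W; simp
      map_smul' := fun c P => by funext W; simp [smul_eval] }
  have : Q.SIw β σ ≤ (restrictTotalDegree (Co Q β) ℂ D).map E := by
    rintro f ⟨⟨P, hP⟩, hf⟩
    refine ⟨P, ?_, ?_⟩
    · rw [SetLike.mem_coe, mem_restrictTotalDegree]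
      apply degree_bound n hn σ
      intro g W
      have := hf g W
      rw [hP, hP] at this
      exact this
    · funext W
      exact (hP W).symm
  exact Submodule.finiteDimensional_of_le this

lemma circ_ne_zero (hQ : Q.Acyclic) (α : Q.V → ℕ) : Q.circ α β ≠ 0 ↔
    ∃ P : MvPolynomial (Co Q β) ℂ, P ≠ 0 ∧ SemiInv P (Q.weightOf α) := by
  have := finite_SIw (β := β) hQ (Q.weightOf α)
  rw [FinQuiver.circ, FinQuiver.siDim, ne_eq, Submodule.finrank_eq_zero, Submodule.eq_bot_iff]
  push Not
  constructor
  · rintro ⟨f, ⟨⟨P, hP⟩, hf⟩, hf0⟩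
    refine ⟨P, ?_, ?_⟩
    · rintro rfl
      apply hf0
      funext W
      simp [hP W]
    · intro g W
      have := hf g W
      rw [hP, hP] at this
      exact this
  · rintro ⟨P, hP0, hP⟩
    refine ⟨fun W => eval (ofRep W) P, ⟨⟨P, fun W => rfl⟩, hP⟩, ?_⟩
    intro h
    apply hP0
    apply MvPolynomial.funext
    intro x
    rw [map_zero]
    exact congrFun h (toRep x)

end QSI

namespace QSI
open MvPolynomial
variable {Q : FinQuiver} {β : Q.V → ℕ}

lemma detWeight_ne_zero (σ : Q.V → ℤ) (g : Q.GLb β) : Q.detWeight σ g ≠ 0 := by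
  refine Finset.prod_ne_zero_iff.2 fun x _ => zpow_ne_zero _ ?_
  have : IsUnit (g x).val := Units.isUnit _
  rw [Matrix.isUnit_iff_isUnit_det] at this
  exact this.ne_zero

/-- weight picking out one row of one arrow -/
def wr (Q : FinQuiver) (β : Q.V → ℕ) (a : Q.A) (i : Fin (β (Q.h a))) (v : Co Q β) : ℕ :=
  if (⟨v.1, v.2.1⟩ : (a : Q.A) × Fin (β (Q.h a))) = ⟨a, i⟩ then 1 else 0

lemma exists_unit_row {n : ℕ} (x : Fin n → ℂ) (q : Fin n) (hx : x q ≠ 0) :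
    ∃ u : (Matrix (Fin n) (Fin n) ℂ)ˣ, ∀ q', ∑ k, x k * u.val k q' = if q' = q then 1 else 0 := by
  let B : Matrix (Fin n) (Fin n) ℂ := Matrix.updateRow 1 q x
  have hB : B.det = x q := by
    have h := Matrix.det_updateRow_sum (1 : Matrix (Fin n) (Fin n) ℂ) q x
    have h2 : (∑ k, x k • (1 : Matrix (Fin n) (Fin n) ℂ) k) = x := by
      funext j
      simp [Finset.sum_apply, Matrix.one_apply]
    rw [h2] at h
    simpa [B] using h
  have hu : IsUnit B := by
    rw [Matrix.isUnit_iff_isUnit_det, hB]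
    exact hx.isUnit
  refine ⟨hu.unit⁻¹, fun q' => ?_⟩
  have h1 : (hu.unit.val * (hu.unit⁻¹).val) q q' = (1 : Matrix (Fin n) (Fin n) ℂ) q q' := by
    rw [Units.mul_inv]
  rw [Matrix.mul_apply, Matrix.one_apply] at h1
  simp only [IsUnit.unit_spec, B, Matrix.updateRow_self] at h1
  rw [h1]
  simp [eq_comm]

lemma row_bound {P : MvPolynomial (Co Q β) ℂ} {σ : Q.V → ℤ} (hP : SemiInv P σ) (a : Q.A)
    (hne : Q.h a ≠ Q.t a) (i : Fin (β (Q.h a))) (K : ℕ)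
    (hK : ∀ m ∈ P.support, ∀ q, coldeg m ⟨Q.t a, q⟩ ≤ K) :
    ∀ m ∈ P.support, ∑ v, wr Q β a i v * m v ≤ K := by
  intro m hm
  by_contra hcon
  push Not at hcon
  refine coeff_pw_zero (wr Q β a i) P _ ?_ m hm rfl
  generalize ∑ v, wr Q β a i v * m v = e at hcon
  intro x
  by_cases hx : ∃ q, x ⟨a, i, q⟩ ≠ 0
  · obtain ⟨q, hq⟩ := hx
    obtain ⟨u, hu⟩ := exists_unit_row (fun k => x ⟨a, i, k⟩) q hq
    let g : Q.GLb β := Function.update (fun y => (1 : (Matrix (Fin (β y)) (Fin (β y)) ℂ)ˣ)) (Q.t a) u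
    let y0 : Co Q β → ℂ := ofRep (Q.invAct g (toRep x))
    let w' : Co Q β → ℕ := fun v => if v = ⟨a, i, q⟩ then 1 else 0
    have key : ∀ s : ℂ, ofRep (Q.invAct g (toRep fun v => s ^ wr Q β a i v * x v)) =
        fun v => s ^ w' v * y0 v := by
      intro s
      funext v
      obtain ⟨b, p, q'⟩ := v
      by_cases hb : b = a
      · subst hb
        have gh : g (Q.h b) = 1 := Function.update_of_ne hne _ _
        have gt : g (Q.t b) = u := Function.update_self _ _ _
        have ev : ∀ z : Co Q β → ℂ, ofRep (Q.invAct g (toRep z)) ⟨b, p, q'⟩ =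
            ∑ k, z ⟨b, p, k⟩ * u.val k q' := by
          intro z
          have : ofRep (Q.invAct g (toRep z)) ⟨b, p, q'⟩ =
            (((g (Q.h b))⁻¹).val * toRep z b * (g (Q.t b)).val) p q' := rfl
          rw [this, gh, gt, inv_one, Units.val_one, Matrix.one_mul, Matrix.mul_apply]
          rfl
        rw [ev]
        simp only [y0]
        rw [ev]
        by_cases hp : p = i
        · subst hp
          simp only [wr, if_true, w', pow_one]
          simp only [mul_assoc, ← Finset.mul_sum, hu]
          by_cases hq' : q' = q
          · simp [hq']
          · simp [hq']
        · have h1 : ∀ k, wr Q β b i ⟨b, p, k⟩ = 0 := by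
            intro k
            simp [wr, hp]
          have h2 : w' ⟨b, p, q'⟩ = 0 := by
            simp [w', hp]
          simp [h1, h2]
      · have h2 : w' ⟨b, p, q'⟩ = 0 := by
          simp [w', hb]
        rw [h2, pow_zero, one_mul]
        simp only [y0, ofRep, FinQuiver.invAct]
        have h4 : toRep (fun v => s ^ wr Q β a i v * x v) b = toRep x b := by
          ext k l
          simp [toRep, wr, hb]
        rw [h4]
    have hpoly : pw w' P y0 = Polynomial.C (Q.detWeight σ g) * pw (wr Q β a i) P x := by
      apply Polynomial.funext
      intro s
      rw [eval_pw, Polynomial.eval_mul, Polynomial.eval_C, eval_pw, ← key s, hP g]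
      rfl
    have hdeg : (pw w' P y0).natDegree ≤ K := by
      apply natDegree_pw
      intro m hm
      refine le_trans ?_ (hK m hm q)
      simp only [w', coldeg]
      refine Finset.sum_le_sum fun v _ => ?_
      by_cases hv : v = ⟨a, i, q⟩
      · subst hv
        simp [cI]
      · simp [hv]
    have h3 := Polynomial.coeff_eq_zero_of_natDegree_lt (lt_of_le_of_lt hdeg hcon)
    rw [hpoly, Polynomial.coeff_C_mul] at h3
    exact (mul_eq_zero.1 h3).resolve_left (detWeight_ne_zero _ _)
  · push Not at hx
    have : pw (wr Q β a i) P x = Polynomial.C (eval x P) := by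
      apply Polynomial.funext
      intro s
      rw [eval_pw, Polynomial.eval_C]
      congr 2
      funext v
      obtain ⟨b, p, q'⟩ := v
      by_cases h : (⟨b, p⟩ : (a : Q.A) × Fin (β (Q.h a))) = ⟨a, i⟩
      · cases h
        simp [hx]
      · simp [wr, h]
    rw [this, Polynomial.coeff_C, if_neg (by omega)]

/-- total incoming multiplicity -/
def Nw (Q : FinQuiver) (α : Q.V → ℕ) (x : Q.V) : ℕ := ∑ a, if Q.h a = x then α (Q.t a) else 0

lemma weightOf_eq (α : Q.V → ℕ) (x : Q.V) : Q.weightOf α x = (α x : ℤ) - Nw Q α x := by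
  simp [FinQuiver.weightOf, Nw]

lemma rowdeg_le (hQ : Q.Acyclic) (α : Q.V → ℕ) {P : MvPolynomial (Co Q β) ℂ}
    (hP : SemiInv P (Q.weightOf α)) :
    ∀ m ∈ P.support, ∀ i, rowdeg m i ≤ Nw Q α i.1 := by
  obtain ⟨n, hn⟩ := exists_rank Q hQ
  have main : ∀ k x, n x = k → ∀ m ∈ P.support, ∀ i, rowdeg m ⟨x, i⟩ ≤ Nw Q α x := by
    intro k
    induction k using Nat.strong_induction_on with
    | _ k ih =>
      intro x hx m hm i
      have e1 : rowdeg m ⟨x, i⟩ = ∑ a : Q.A, ∑ pq : Fin (β (Q.h a)) × Fin (β (Q.t a)),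
          if (⟨Q.h a, pq.1⟩ : Ix Q β) = ⟨x, i⟩ then m ⟨a, pq⟩ else 0 := by
        rw [rowdeg, Fintype.sum_sigma]
        rfl
      rw [e1, Nw]
      refine Finset.sum_le_sum fun a _ => ?_
      by_cases ha : Q.h a = x
      · subst ha
        rw [if_pos rfl]
        refine le_trans ?_ (row_bound hP a (fun h => by have := hn a; rw [h] at this; omega)
          i (α (Q.t a)) ?_ m hm)
        · rw [Fintype.sum_sigma]
          refine le_trans ?_ (Finset.single_le_sum (fun _ _ => Nat.zero_le _) (Finset.mem_univ a))
          refine Finset.sum_le_sum fun pq _ => ?_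
          by_cases hp : pq.1 = i
          · simp [wr, hp]
          · simp [hp]
        · intro m hm q
          have h1 := torus hP m hm ⟨Q.t a, q⟩
          have h2 := ih (n (Q.t a)) (hx ▸ hn a) _ rfl m hm q
          rw [weightOf_eq] at h1
          simp only at h1
          omega
      · rw [if_neg ha, Finset.sum_eq_zero]
        intro pq _
        rw [if_neg]
        intro h
        exact ha (congrArg Sigma.fst h)
  intro m hm i
  exact main _ i.1 rfl m hm i.2

end QSI

namespace QSI
open MvPolynomial
variable {Q : FinQuiver} {β : Q.V → ℕ}

/-- extra square matrix coordinates -/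
abbrev Xi (Q : FinQuiver) (β : Q.V → ℕ) : Type := (x : Q.V) × (Fin (β x) × Fin (β x))

/-- families of square matrices -/
abbrev Sq (Q : FinQuiver) (β : Q.V → ℕ) : Type := ∀ x : Q.V, Matrix (Fin (β x)) (Fin (β x)) ℂ

/-- the point with coordinates W, X -/
def pt (W : Q.Rep β) (X : Sq Q β) : Co Q β ⊕ Xi Q β → ℂ :=
  Sum.elim (ofRep W) (fun e => X e.1 e.2.1 e.2.2)

/-- X inverse times W -/
noncomputable def xinv (W : Q.Rep β) (X : Sq Q β) : Q.Rep β :=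
  fun a => (X (Q.h a))⁻¹ * W a

/-- clearing of denominators -/
def Good (P : MvPolynomial (Co Q β) ℂ) (L : Q.V → ℕ) (G : MvPolynomial (Co Q β ⊕ Xi Q β) ℂ) : Prop :=
  ∀ (W : Q.Rep β) (X : Sq Q β), (∀ x, (X x).det ≠ 0) →
    eval (pt W X) G = (∏ x, (X x).det ^ L x) * eval (ofRep (xinv W X)) P

/-- generic matrix at a vertex -/
noncomputable def gM (Q : FinQuiver) (β : Q.V → ℕ) (x : Q.V) :
    Matrix (Fin (β x)) (Fin (β x)) (MvPolynomial (Co Q β ⊕ Xi Q β) ℂ) :=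
  genMat fun p q => Sum.inr ⟨x, p, q⟩

lemma eval_gM (W : Q.Rep β) (X : Sq Q β) (x : Q.V) : eval (pt W X) (gM Q β x).det = (X x).det := by
  rw [gM, eval_genMat]
  rfl

lemma eval_adj (W : Q.Rep β) (X : Sq Q β) (x : Q.V) (p q) :
    eval (pt W X) ((gM Q β x).adjugate p q) = (X x).adjugate p q := by
  have h := RingHom.map_adjugate (eval (pt W X)) (gM Q β x)
  have h2 : (eval (pt W X)).mapMatrix (gM Q β x) = X x := by
    ext i j
    simp [gM, genMat, pt]
  rw [h2] at h
  have := congrFun (congrFun h p) q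
  simpa using this

lemma good_start (P : MvPolynomial (Co Q β) ℂ) :
    ∃ d0, ∀ d ≥ d0, ∃ G, Good P (fun _ => d) G := by
  induction P using MvPolynomial.induction_on with
  | C c =>
    refine ⟨0, fun d _ => ⟨(∏ x, (gM Q β x).det ^ d) * C c, fun W X _ => ?_⟩⟩
    simp [map_prod, eval_gM]
  | add p q hp hq =>
    obtain ⟨d1, h1⟩ := hp
    obtain ⟨d2, h2⟩ := hq
    refine ⟨max d1 d2, fun d hd => ?_⟩
    obtain ⟨G1, g1⟩ := h1 d (le_trans (le_max_left _ _) hd)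
    obtain ⟨G2, g2⟩ := h2 d (le_trans (le_max_right _ _) hd)
    refine ⟨G1 + G2, fun W X hX => ?_⟩
    rw [map_add, g1 W X hX, g2 W X hX, map_add]
    ring
  | mul_X p v hp =>
    obtain ⟨d1, h1⟩ := hp
    refine ⟨d1 + 1, fun d hd => ?_⟩
    obtain ⟨d, rfl⟩ : ∃ d', d = d' + 1 := ⟨d - 1, by omega⟩
    obtain ⟨G1, g1⟩ := h1 d (by omega)
    refine ⟨G1 * ((∏ y ∈ Finset.univ.erase (Q.h v.1), (gM Q β y).det) *
      ∑ k, (gM Q β (Q.h v.1)).adjugate v.2.1 k * X (Sum.inl ⟨v.1, k, v.2.2⟩)), fun W X hX => ?_⟩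
    rw [map_mul, g1 W X hX, map_mul, map_mul, eval_X]
    have e1 : eval (pt W X) (∑ k, (gM Q β (Q.h v.1)).adjugate v.2.1 k *
        MvPolynomial.X (Sum.inl ⟨v.1, k, v.2.2⟩)) =
        (X (Q.h v.1)).det * ofRep (xinv W X) v := by
      have : ofRep (xinv W X) v = ((X (Q.h v.1))⁻¹ * W v.1) v.2.1 v.2.2 := rfl
      rw [this, Matrix.inv_def, Matrix.smul_mul, Matrix.smul_apply, Ring.inverse_eq_inv',
        smul_eq_mul, ← mul_assoc, mul_inv_cancel₀ (hX _), one_mul, Matrix.mul_apply, map_sum]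
      refine Finset.sum_congr rfl fun k _ => ?_
      rw [map_mul, eval_adj, eval_X]
      rfl
    have e2 : ∏ x, (X x).det ^ (d+1) = (∏ x, (X x).det ^ d) * ((X (Q.h v.1)).det *
        ∏ y ∈ Finset.univ.erase (Q.h v.1), (X y).det) := by
      rw [Finset.mul_prod_erase _ (fun y => (X y).det) (Finset.mem_univ _), ← Finset.prod_mul_distrib]
      exact Finset.prod_congr rfl fun x _ => pow_succ _ _
    rw [e1, e2, map_prod]
    simp only [eval_gM]
    ring

lemma pole {σ : Type} [Fintype σ] (w : σ → ℕ) (E : ℕ) (P : MvPolynomial σ ℂ) (x : σ → ℂ)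
    (h : ∀ m ∈ P.support, ∑ v, w v * m v < E) :
    ∃ R : ℂ → ℂ, Continuous R ∧ ∀ s ≠ 0,
      s ^ E * eval (fun v => (s ^ w v)⁻¹ * x v) P = s * R s := by
  refine ⟨fun s => ∑ m ∈ P.support, (coeff m P * ∏ v, x v ^ m v) * s ^ (E - 1 - ∑ v, w v * m v),
    by fun_prop, fun s hs => ?_⟩
  rw [eval_eq', Finset.mul_sum, Finset.mul_sum]
  refine Finset.sum_congr rfl fun m hm => ?_
  have h1 : s ^ E = s * s ^ (E - 1 - ∑ v, w v * m v) * s ^ (∑ v, w v * m v) := by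
    rw [← pow_succ', ← pow_add]
    congr 1
    have := h m hm
    omega
  simp only [mul_pow, Finset.prod_mul_distrib, inv_pow, ← pow_mul, Finset.prod_inv_distrib,
    Finset.prod_pow_eq_pow_sum]
  rw [h1]
  have : s ^ (∑ v, w v * m v) ≠ 0 := pow_ne_zero _ hs
  field_simp

lemma exists_UDV {n : ℕ} (M : Matrix (Fin n) (Fin n) ℂ) :
    ∃ (U V : Matrix (Fin n) (Fin n) ℂ) (D : Fin n → ℂ), U.det = 1 ∧ V.det = 1 ∧
      M = U * Matrix.diagonal D * V := by
  obtain ⟨L, L', D, h⟩ := Matrix.Pivot.exists_list_transvec_mul_diagonal_mul_list_transvec M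
  exact ⟨_, _, D, Matrix.TransvectionStruct.det_toMatrix_prod L,
    Matrix.TransvectionStruct.det_toMatrix_prod L', h⟩

end QSI

namespace QSI
open MvPolynomial
variable {Q : FinQuiver} {β : Q.V → ℕ}

lemma good_vanish {P : MvPolynomial (Co Q β) ℂ} {σ : Q.V → ℤ} (hP : SemiInv P σ) (N : Q.V → ℕ)
    (hrow : ∀ m ∈ P.support, ∀ i, rowdeg m i ≤ N i.1) (L : Q.V → ℕ)
    (G : MvPolynomial (Co Q β ⊕ Xi Q β) ℂ) (hG : Good P L G) (hL : ∀ y, N y ≤ L y)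
    (x : Q.V) (hx : N x < L x) (W : Q.Rep β) (X : Sq Q β) (hdet : (X x).det = 0) :
    eval (pt W X) G = 0 := by
  choose U V D hU hV hX using fun y => exists_UDV (X y)
  let ζ : Ix Q β → ℕ := fun i => if D i.1 i.2 = 0 then 1 else 0
  let D1 : Ix Q β → ℂ := fun i => if D i.1 i.2 = 0 then 1 else D i.1 i.2
  have hD1 : ∀ i, D1 i ≠ 0 := by
    intro i
    simp only [D1]
    split_ifs with h
    · simp
    · exact h
  let Xs : ℂ → Sq Q β := fun s y =>
    U y * Matrix.diagonal (fun i => s ^ ζ ⟨y, i⟩ * D1 ⟨y, i⟩) * V y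
  have hX0 : Xs 0 = X := by
    funext y
    rw [hX y]
    simp only [Xs]
    congr 3
    funext i
    simp only [ζ, D1]
    split_ifs with h <;> simp [h]
  -- the exponent
  let E : ℕ := ∑ i : Ix Q β, ζ i * L i.1
  have hζ : ∃ i : Fin (β x), ζ ⟨x, i⟩ = 1 := by
    rw [hX x, Matrix.det_mul, Matrix.det_mul, hU, hV, Matrix.det_diagonal, one_mul, mul_one,
      Finset.prod_eq_zero_iff] at hdet
    obtain ⟨i, _, hi⟩ := hdet
    exact ⟨i, by simp [ζ, hi]⟩
  have hE : ∀ m ∈ P.support, ∑ v, ζ (rI v) * m v < E := by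
    intro m hm
    have h1 := sum_rowdeg m (fun i => (ζ i : ℤ))
    have h2 : ∑ v, ζ (rI v) * m v = ∑ i, ζ i * rowdeg m i := by
      have := h1.symm
      exact_mod_cast this
    rw [h2]
    obtain ⟨i, hi⟩ := hζ
    refine Finset.sum_lt_sum (fun j _ => Nat.mul_le_mul_left _ ((hrow m hm j).trans (hL _)))
      ⟨⟨x, i⟩, Finset.mem_univ _, ?_⟩
    rw [hi, one_mul, one_mul]
    exact lt_of_le_of_lt (hrow m hm _) hx
  have iU : ∀ y, IsUnit (U y).det := fun y => by rw [hU]; exact isUnit_one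
  have iV : ∀ y, IsUnit (V y).det := fun y => by rw [hV]; exact isUnit_one
  let g : Q.GLb β := fun y => ((Matrix.isUnit_iff_isUnit_det _).2 (iV y)).unit
  have hg : ∀ y, (g y).val = V y := fun y => rfl
  have hg' : ∀ y, ((g y)⁻¹).val = (V y)⁻¹ := fun y => by
    rw [Matrix.coe_units_inv, hg]
  let W0 : Q.Rep β := fun a => (U (Q.h a))⁻¹ * W a * (V (Q.t a))⁻¹
  let x1 : Co Q β → ℂ := fun v => (D1 (rI v))⁻¹ * ofRep W0 v
  obtain ⟨R, hRc, hR⟩ := pole (fun v => ζ (rI v)) E P x1 hE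
  have hdets : ∀ s y, (Xs s y).det = s ^ (∑ i, ζ ⟨y, i⟩) * ∏ i, D1 ⟨y, i⟩ := by
    intro s y
    simp only [Xs]
    rw [Matrix.det_mul, Matrix.det_mul, hU, hV, Matrix.det_diagonal, one_mul, mul_one,
      Finset.prod_mul_distrib, Finset.prod_pow_eq_pow_sum]
  have hs : ∀ s ≠ 0, eval (pt W (Xs s)) G = (∏ y, (∏ i, D1 ⟨y, i⟩) ^ L y) * Q.detWeight σ g *
      (s * R s) := by
    intro s hs0
    have hne : ∀ i : Ix Q β, s ^ ζ i * D1 i ≠ 0 := fun i => mul_ne_zero (pow_ne_zero _ hs0) (hD1 i)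
    rw [hG W (Xs s) (fun y => by
      rw [hdets]
      exact mul_ne_zero (pow_ne_zero _ hs0) (Finset.prod_ne_zero_iff.2 fun i _ => hD1 _))]
    have e1 : ∏ y, (Xs s y).det ^ L y = s ^ E * ∏ y, (∏ i, D1 ⟨y, i⟩) ^ L y := by
      simp only [hdets, mul_pow, Finset.prod_mul_distrib, ← pow_mul, Finset.prod_pow_eq_pow_sum]
      congr 2
      simp only [E]
      rw [Fintype.sum_sigma]
      refine Finset.sum_congr rfl fun y _ => ?_
      rw [Finset.sum_mul]
    let W2 : Q.Rep β := fun a =>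
      Matrix.diagonal (fun i => (s ^ ζ ⟨Q.h a, i⟩ * D1 ⟨Q.h a, i⟩)⁻¹) * W0 a
    have e2 : xinv W (Xs s) = Q.invAct g W2 := by
      funext a
      simp only [xinv, FinQuiver.invAct, hg, hg', Xs, W2, W0]
      rw [Matrix.mul_inv_rev, Matrix.mul_inv_rev]
      have : (Matrix.diagonal (fun i => s ^ ζ ⟨Q.h a, i⟩ * D1 ⟨Q.h a, i⟩))⁻¹ =
          Matrix.diagonal (fun i => (s ^ ζ ⟨Q.h a, i⟩ * D1 ⟨Q.h a, i⟩)⁻¹) := by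
        apply Matrix.inv_eq_right_inv
        rw [Matrix.diagonal_mul_diagonal]
        rw [← Matrix.diagonal_one]
        congr 1
        funext i
        exact mul_inv_cancel₀ (hne _)
      rw [this]
      simp only [Matrix.mul_assoc]
      rw [Matrix.nonsing_inv_mul _ (iV _), Matrix.mul_one]
    have e3 : ofRep W2 = fun v => (s ^ ζ (rI v))⁻¹ * x1 v := by
      funext v
      have : ofRep W2 v = (Matrix.diagonal (fun i => (s ^ ζ ⟨Q.h v.1, i⟩ * D1 ⟨Q.h v.1, i⟩)⁻¹)
        * W0 v.1) v.2.1 v.2.2 := rfl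
      rw [this, Matrix.diagonal_mul, mul_inv, mul_assoc]
      rfl
    rw [e1, e2, hP g W2, e3, ← hR s hs0]
    ring
  have c1 : Continuous fun s => eval (pt W (Xs s)) G := by
    have hc : Continuous fun s => pt W (Xs s) := by
      apply continuous_pi
      rintro (v | e)
      · exact continuous_const
      · simp only [pt, Sum.elim_inr, Xs, Matrix.mul_apply, Matrix.mul_diagonal]
        fun_prop
    exact (MvPolynomial.continuous_eval G).comp hc
  have c2 : Continuous fun s => (∏ y, (∏ i, D1 ⟨y, i⟩) ^ L y) * Q.detWeight σ g *
      (s * R s) := by fun_prop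
  have := Continuous.ext_on (dense_compl_singleton (0:ℂ)) c1 c2 (fun s hs0 => hs s hs0)
  have h0 := congrFun this 0
  simp only [hX0, zero_mul, mul_zero] at h0
  exact h0

lemma good_step {P : MvPolynomial (Co Q β) ℂ} {σ : Q.V → ℤ} (hP : SemiInv P σ) (N : Q.V → ℕ)
    (hrow : ∀ m ∈ P.support, ∀ i, rowdeg m i ≤ N i.1) (L : Q.V → ℕ)
    (G : MvPolynomial (Co Q β ⊕ Xi Q β) ℂ) (hG : Good P L G) (hL : ∀ y, N y ≤ L y)
    (x : Q.V) (hx : N x < L x) : ∃ G', Good P (Function.update L x (L x - 1)) G' := by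
  have hd : (gM Q β x).det ∣ G := by
    apply genMat_dvd
    · intro p q h
      simp only [Sum.inr.injEq, Sigma.mk.injEq, heq_eq_eq, true_and] at h
      exact Prod.ext_iff.2 ⟨congrArg Prod.fst h, congrArg Prod.snd h⟩
    · intro z hz
      let W : Q.Rep β := toRep fun v => z (Sum.inl v)
      let X : Sq Q β := fun y => Matrix.of fun p q => z (Sum.inr ⟨y, p, q⟩)
      have hz' : z = pt W X := by
        funext v
        rcases v with v | v <;> rfl
      rw [hz'] at hz ⊢
      have h2 := eval_gM W X x
      rw [gM] at h2
      rw [h2] at hz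
      exact good_vanish hP N hrow L G hG hL x hx W X hz
  obtain ⟨G', rfl⟩ := hd
  refine ⟨G', fun W X hX => ?_⟩
  have h := hG W X hX
  rw [map_mul, eval_gM] at h
  apply mul_left_cancel₀ (hX x)
  rw [h, ← mul_assoc]
  congr 1
  rw [← Finset.mul_prod_erase _ (fun y => (X y).det ^ L y) (Finset.mem_univ x),
    ← Finset.mul_prod_erase _ (fun y => (X y).det ^ Function.update L x (L x - 1) y)
      (Finset.mem_univ x), ← mul_assoc, Function.update_self, ← pow_succ']
  have e1 : L x - 1 + 1 = L x := by omega
  have e2 : ∏ y ∈ Finset.univ.erase x, (X y).det ^ Function.update L x (L x - 1) y =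
      ∏ y ∈ Finset.univ.erase x, (X y).det ^ L y := Finset.prod_congr rfl fun y hy => by
    rw [Function.update_of_ne (Finset.ne_of_mem_erase hy)]
  rw [e1, e2]

lemma exists_good {P : MvPolynomial (Co Q β) ℂ} {σ : Q.V → ℤ} (hP : SemiInv P σ) (N : Q.V → ℕ)
    (hrow : ∀ m ∈ P.support, ∀ i, rowdeg m i ≤ N i.1) : ∃ G, Good P N G := by
  have main : ∀ (k : ℕ) (L : Q.V → ℕ), (∀ y, N y ≤ L y) → ∑ y, (L y - N y) = k →
      (∃ G, Good P L G) → ∃ G, Good P N G := by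
    intro k
    induction k with
    | zero =>
      intro L hL hs hG
      have : L = N := by
        funext y
        have h1 := (Finset.sum_eq_zero_iff.1 hs) y (Finset.mem_univ _)
        have := hL y
        omega
      rwa [this] at hG
    | succ k ih =>
      intro L hL hs ⟨G, hG⟩
      obtain ⟨x, hx⟩ : ∃ x, N x < L x := by
        by_contra hcon
        push Not at hcon
        have : ∑ y, (L y - N y) = 0 := Finset.sum_eq_zero fun y _ => by
          have := hcon y
          omega
        omega
      refine ih (Function.update L x (L x - 1)) ?_ ?_ (good_step hP N hrow L G hG hL x hx)
      · intro y
        by_cases h : y = x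
        · subst h
          simp
          omega
        · simp [h, hL y]
      · have e1 := Finset.add_sum_erase Finset.univ (fun y => L y - N y) (Finset.mem_univ x)
        have e2 := Finset.add_sum_erase Finset.univ
          (fun y => Function.update L x (L x - 1) y - N y) (Finset.mem_univ x)
        have e3 : ∑ y ∈ Finset.univ.erase x, (Function.update L x (L x - 1) y - N y) =
            ∑ y ∈ Finset.univ.erase x, (L y - N y) := Finset.sum_congr rfl fun y hy => by
          rw [Function.update_of_ne (Finset.ne_of_mem_erase hy)]
        simp only [Function.update_self] at e2
        rw [e3] at e2
        omega
  obtain ⟨d0, h⟩ := good_start P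
  refine main _ (fun _ => d0 + ∑ y, N y) (fun y => ?_) rfl (h _ (by omega))
  have := Finset.single_le_sum (f := N) (fun _ _ => Nat.zero_le _) (Finset.mem_univ y)
  omega

end QSI

namespace QSI
open MvPolynomial
variable {Q : FinQuiver} {β : Q.V → ℕ}

lemma finite_bad {n : ℕ} (Y : Matrix (Fin n) (Fin n) ℂ) :
    {z : ℂ | (Y + Matrix.diagonal (fun _ => z)).det = 0}.Finite := by
  have h0 : (-Y).charpoly ≠ 0 := (Matrix.charpoly_monic _).ne_zero
  refine (Polynomial.finite_setOfPred_isRoot h0).subset fun z hz => ?_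
  simp only [Set.mem_ofPred_eq] at hz ⊢
  rw [Polynomial.IsRoot, Matrix.eval_charpoly]
  rw [← hz, sub_neg_eq_add, add_comm]
  rfl

/-- two-sided multiplication -/
noncomputable def sand (Y : Sq Q β) (W : Q.Rep β) (X : Sq Q β) : Q.Rep β :=
  fun a => Y (Q.h a) * W a * X (Q.t a)

lemma good_sym1 {P : MvPolynomial (Co Q β) ℂ} {α : Q.V → ℕ} (hP : SemiInv P (Q.weightOf α))
    {G : MvPolynomial (Co Q β ⊕ Xi Q β) ℂ} (hG : Good P (Nw Q α) G) (W : Q.Rep β) (Y X : Sq Q β)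
    (hY : ∀ x, (Y x).det ≠ 0) (hX : ∀ x, (X x).det ≠ 0) :
    eval (pt (sand Y W X) (fun x => Y x * X x)) G =
      (∏ x, (Y x).det ^ Nw Q α x) * (∏ x, (X x).det ^ α x) * eval (ofRep W) P := by
  rw [hG _ _ (fun x => by rw [Matrix.det_mul]; exact mul_ne_zero (hY x) (hX x))]
  let g : Q.GLb β := fun y => ((Matrix.isUnit_iff_isUnit_det _).2 (hX y).isUnit).unit
  have hg : ∀ y, (g y).val = X y := fun y => rfl
  have hg' : ∀ y, ((g y)⁻¹).val = (X y)⁻¹ := fun y => by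
    rw [Matrix.coe_units_inv, hg]
  have e : xinv (sand Y W X) (fun x => Y x * X x) = Q.invAct g W := by
    funext a
    simp only [xinv, sand, FinQuiver.invAct, hg, hg']
    rw [Matrix.mul_inv_rev]
    simp only [Matrix.mul_assoc]
    rw [← Matrix.mul_assoc (Y (Q.h a))⁻¹, Matrix.nonsing_inv_mul _ (hY _).isUnit, Matrix.one_mul]
  rw [e, hP g W, ← mul_assoc]
  congr 1
  simp only [FinQuiver.detWeight, hg, ← Finset.prod_mul_distrib]
  refine Finset.prod_congr rfl fun x _ => ?_
  rw [Matrix.det_mul, mul_pow, mul_assoc]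
  congr 1
  rw [weightOf_eq, ← zpow_natCast, ← zpow_natCast, ← zpow_add₀ (hX x)]
  congr 1
  ring

lemma good_sym {P : MvPolynomial (Co Q β) ℂ} {α : Q.V → ℕ} (hP : SemiInv P (Q.weightOf α))
    {G : MvPolynomial (Co Q β ⊕ Xi Q β) ℂ} (hG : Good P (Nw Q α) G) (W : Q.Rep β) (Y X : Sq Q β) :
    eval (pt (sand Y W X) (fun x => Y x * X x)) G =
      (∏ x, (Y x).det ^ Nw Q α x) * (∏ x, (X x).det ^ α x) * eval (ofRep W) P := by
  let Yz : ℂ → Sq Q β := fun z x => Y x + Matrix.diagonal (fun _ => z)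
  let Xz : ℂ → Sq Q β := fun z x => X x + Matrix.diagonal (fun _ => z)
  let B : Set ℂ := (⋃ x, {z : ℂ | (Yz z x).det = 0}) ∪ (⋃ x, {z : ℂ | (Xz z x).det = 0})
  have hB : B.Finite := (Set.finite_iUnion fun x => finite_bad (Y x)).union
    (Set.finite_iUnion fun x => finite_bad (X x))
  have hd : Dense Bᶜ := hB.countable.dense_compl ℂ
  have cY : ∀ x, Continuous fun z => Yz z x := fun x =>
    continuous_const.add (Continuous.matrix_diagonal (continuous_pi fun _ => continuous_id))
  have cX : ∀ x, Continuous fun z => Xz z x := fun x =>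
    continuous_const.add (Continuous.matrix_diagonal (continuous_pi fun _ => continuous_id))
  have c1 : Continuous fun z => eval (pt (sand (Yz z) W (Xz z)) (fun x => Yz z x * Xz z x)) G := by
    refine (MvPolynomial.continuous_eval G).comp (continuous_pi ?_)
    rintro (v | e)
    · have : Continuous fun z => Yz z (Q.h v.1) * W v.1 * Xz z (Q.t v.1) :=
        ((cY _).matrix_mul continuous_const).matrix_mul (cX _)
      exact this.matrix_elem _ _
    · have : Continuous fun z => Yz z e.1 * Xz z e.1 := (cY _).matrix_mul (cX _)
      exact this.matrix_elem _ _
  have c2 : Continuous fun z => (∏ x, (Yz z x).det ^ Nw Q α x) * (∏ x, (Xz z x).det ^ α x) *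
      eval (ofRep W) P := by
    refine (Continuous.mul (continuous_finsetProd _ fun x _ => ((cY x).matrix_det).pow _)
      (continuous_finsetProd _ fun x _ => ((cX x).matrix_det).pow _)).mul continuous_const
  have := Continuous.ext_on hd c1 c2 (fun z hz => by
    simp only [B, Set.mem_compl_iff, Set.mem_union, Set.mem_iUnion, Set.mem_ofPred_eq, not_or,
      not_exists] at hz
    exact good_sym1 hP hG W (Yz z) (Xz z) hz.1 hz.2)
  have h0 := congrFun this 0
  have eY : Yz 0 = Y := by funext x; simp [Yz]
  have eX : Xz 0 = X := by funext x; simp [Xz]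
  simp only [eY, eX] at h0
  exact h0
end QSI

namespace QSI
open MvPolynomial
variable {Q : FinQuiver} {β : Q.V → ℕ}

/-- blocks of basis vectors -/
abbrev Rg (β : Q.V → ℕ) {B : Type} (vb : B → Q.V) : Type := (b : B) × Fin (β (vb b))

/-- underlying basis vector -/
def rgi {B : Type} {vb : B → Q.V} (r : Rg β vb) : Ix Q β := ⟨vb r.1, r.2⟩

lemma rgi_inj {B : Type} {vb : B → Q.V} (r r' : Rg β vb) (h : rgi r = rgi r') (h1 : r.1 = r'.1) :
    r = r' := by
  obtain ⟨b, p⟩ := r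
  obtain ⟨b', p'⟩ := r'
  simp only at h1
  subst h1
  simp only [rgi, Sigma.mk.injEq, heq_eq_eq, true_and] at h
  rw [h]

/-- the substitution matrix -/
def Yt {B : Type} [Fintype B] [DecidableEq B] {vb : B → Q.V} (ω : Equiv.Perm (Rg β vb))
    (u : Rg β vb → ℂ) (i i' : Ix Q β) : ℂ :=
  ∑ s, (if rgi s = i ∧ (ω s).1 = s.1 ∧ rgi (ω s) = i' then 1 else 0) * u s

lemma det_blocks {B : Type} [Fintype B] [DecidableEq B] {F : B → Type} [∀ b, Fintype (F b)]
    [∀ b, DecidableEq (F b)] {K : Type} [CommRing K] (M : ∀ b, Matrix (F b) (F b) K) :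
    (Matrix.blockDiagonal' M).det = ∏ b, (M b).det := by
  let ε := Fintype.equivFin B
  have hb : (Matrix.blockDiagonal' M).BlockTriangular (fun s => ε s.1) := by
    intro i j hij
    obtain ⟨i1, i2⟩ := i
    obtain ⟨j1, j2⟩ := j
    apply Matrix.blockDiagonal'_apply_ne
    rintro rfl
    exact lt_irrefl _ hij
  rw [hb.det_fintype, ← Equiv.prod_comp ε]
  refine Finset.prod_congr rfl fun b _ => ?_
  let f : F b ≃ {s : (b : B) × F b // ε s.1 = ε b} :=
    { toFun := fun p => ⟨⟨b, p⟩, rfl⟩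
      invFun := fun s => (ε.injective s.2) ▸ s.1.2
      left_inv := fun p => rfl
      right_inv := by
        rintro ⟨⟨b', p⟩, h⟩
        have h' := ε.injective h
        simp only at h'
        subst h'
        rfl }
  rw [← Matrix.det_submatrix_equiv_self f]
  congr 1
  ext p q
  exact Matrix.blockDiagonal'_apply_eq M b p q

lemma det_Yt {B : Type} [Fintype B] [DecidableEq B] {vb : B → Q.V} (ω : Equiv.Perm (Rg β vb))
    (u : Rg β vb → ℂ) :
    Matrix.det (Matrix.of fun r' r : Rg β vb => ∑ s, (if r'.1 = r.1 ∧ rgi s = rgi r ∧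
      (ω s).1 = s.1 ∧ rgi (ω s) = rgi r' then 1 else 0) * u s) =
    ∏ b, Matrix.det (Matrix.of fun p' p => Yt ω u ⟨vb b, p⟩ ⟨vb b, p'⟩) := by
  rw [← det_blocks]
  congr 1
  ext ⟨b', p'⟩ ⟨b, p⟩
  by_cases h : b' = b
  · subst h
    rw [Matrix.blockDiagonal'_apply_eq]
    simp only [Yt, rgi, Matrix.of_apply]
    refine Finset.sum_congr rfl fun s _ => ?_
    congr 1
    exact if_congr (and_iff_right trivial) rfl rfl
  · rw [Matrix.blockDiagonal'_apply_ne _ _ _ h]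
    simp [h]

lemma sum_Yt {B : Type} [Fintype B] [DecidableEq B] {vb : B → Q.V} (ω : Equiv.Perm (Rg β vb))
    (u : Rg β vb → ℂ) (x : Q.V) (p : Fin (β x)) (f : Ix Q β → ℂ) :
    ∑ r, (if rgi r = ⟨x, p⟩ ∧ (ω r).1 = r.1 then 1 else 0) * f (rgi (ω r)) * u r =
      ∑ p', Yt ω u ⟨x, p⟩ ⟨x, p'⟩ * f ⟨x, p'⟩ := by
  simp only [Yt, Finset.sum_mul]
  rw [Finset.sum_comm]
  refine Finset.sum_congr rfl fun r _ => ?_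
  by_cases h : rgi r = ⟨x, p⟩ ∧ (ω r).1 = r.1
  · have h2 : ∃ p0, rgi (ω r) = (⟨x, p0⟩ : Ix Q β) := by
      have : (rgi (ω r)).1 = x := by
        have h3 := congrArg Sigma.fst h.1
        simp only [rgi] at h3 ⊢
        rw [h.2, h3]
      generalize rgi (ω r) = z at this ⊢
      obtain ⟨y, q⟩ := z
      simp only at this
      subst this
      exact ⟨q, rfl⟩
    obtain ⟨p0, hp0⟩ := h2
    rw [Finset.sum_eq_single p0]
    · simp [h, hp0, mul_comm]
    · intro b _ hb
      have : ¬ (p0 = b) := fun h => hb h.symm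
      simp [hp0, this]
    · simp
  · rw [if_neg h]
    have h' : ∀ p', ¬ (rgi r = ⟨x, p⟩ ∧ (ω r).1 = r.1 ∧ rgi (ω r) = (⟨x, p'⟩ : Ix Q β)) :=
      fun p' hh => h ⟨hh.1, hh.2.1⟩
    simp [h']

lemma sum_Yt2 {B : Type} [Fintype B] [DecidableEq B] {vb : B → Q.V} (ω : Equiv.Perm (Rg β vb))
    (u : Rg β vb → ℂ) {B' : Type} [Fintype B'] [DecidableEq B'] {vb' : B' → Q.V}
    (ω' : Equiv.Perm (Rg β vb')) (v : Rg β vb' → ℂ) (x y : Q.V) (p : Fin (β x)) (q : Fin (β y))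
    (f : Ix Q β → Ix Q β → ℂ) :
    ∑ r, (∑ c, (if rgi r = ⟨x, p⟩ ∧ (ω r).1 = r.1 then 1 else 0) *
      (if rgi c = ⟨y, q⟩ ∧ (ω' c).1 = c.1 then 1 else 0) * f (rgi (ω r)) (rgi (ω' c)) * v c) * u r
    = ∑ q', (∑ p', Yt ω u ⟨x, p⟩ ⟨x, p'⟩ * f ⟨x, p'⟩ ⟨y, q'⟩) * Yt ω' v ⟨y, q⟩ ⟨y, q'⟩ := by
  have h1 : ∀ r, (∑ c, (if rgi r = ⟨x, p⟩ ∧ (ω r).1 = r.1 then 1 else 0) *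
      (if rgi c = ⟨y, q⟩ ∧ (ω' c).1 = c.1 then 1 else 0) * f (rgi (ω r)) (rgi (ω' c)) * v c) * u r
      = (if rgi r = ⟨x, p⟩ ∧ (ω r).1 = r.1 then 1 else 0) *
        (∑ q', Yt ω' v ⟨y, q⟩ ⟨y, q'⟩ * f (rgi (ω r)) ⟨y, q'⟩) * u r := by
    intro r
    rw [← sum_Yt ω' v y q (fun j => f (rgi (ω r)) j)]
    congr 1
    rw [Finset.mul_sum]
    refine Finset.sum_congr rfl fun c _ => ?_
    ring
  simp only [h1]
  rw [sum_Yt ω u x p (fun i => ∑ q', Yt ω' v ⟨y, q⟩ ⟨y, q'⟩ * f i ⟨y, q'⟩)]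
  simp only [Finset.mul_sum, Finset.sum_mul]
  rw [Finset.sum_comm]
  refine Finset.sum_congr rfl fun q' _ => Finset.sum_congr rfl fun p' _ => ?_
  ring

/-- embedding of the coordinates -/
def io (v : Co Q β ⊕ Xi Q β) : (Q.A ⊕ Q.V) × Ix Q β × Ix Q β :=
  match v with
  | Sum.inl v => (Sum.inl v.1, ⟨Q.h v.1, v.2.1⟩, ⟨Q.t v.1, v.2.2⟩)
  | Sum.inr e => (Sum.inr e.1, ⟨e.1, e.2.1⟩, ⟨e.1, e.2.2⟩)

lemma io_inj : Function.Injective (io : Co Q β ⊕ Xi Q β → _) := by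
  rintro (⟨a, p, q⟩ | ⟨x, p, q⟩) (⟨a', p', q'⟩ | ⟨x', p', q'⟩) h
  · simp only [io, Prod.mk.injEq, Sum.inl.injEq] at h
    obtain ⟨rfl, h1, h2⟩ := h
    simp only [Sigma.mk.injEq, heq_eq_eq, true_and] at h1 h2
    rw [h1, h2]
  · simp [io] at h
  · simp [io] at h
  · simp only [io, Prod.mk.injEq, Sum.inr.injEq] at h
    obtain ⟨rfl, h1, h2⟩ := h
    simp only [Sigma.mk.injEq, heq_eq_eq, true_and] at h1 h2
    rw [h1, h2]

/-- extended coordinates of a representation -/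
noncomputable def wt (W : Q.Rep β) : (Q.A ⊕ Q.V) × Ix Q β × Ix Q β → ℂ :=
  Function.extend io (pt W (fun _ => 1)) 0

lemma wt_inl (W : Q.Rep β) (a : Q.A) (p q) :
    wt W (Sum.inl a, ⟨Q.h a, p⟩, ⟨Q.t a, q⟩) = W a p q :=
  io_inj.extend_apply _ _ (Sum.inl ⟨a, p, q⟩)

lemma wt_inr (W : Q.Rep β) (x : Q.V) (p q : Fin (β x)) :
    wt W (Sum.inr x, ⟨x, p⟩, ⟨x, q⟩) = if p = q then 1 else 0 := by
  have := io_inj.extend_apply (pt W (fun _ => 1)) 0 (Sum.inr ⟨x, p, q⟩)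
  refine this.trans ?_
  simp [pt, Matrix.one_apply]

/-- arrows with multiplicity -/
abbrev Bi (Q : FinQuiver) (α : Q.V → ℕ) : Type := (a : Q.A) × Fin (α (Q.t a))

/-- head of an arrow -/
abbrev bh (Q : FinQuiver) (α : Q.V → ℕ) (b : Bi Q α) : Q.V := Q.h b.1

/-- vertex of a basis vector -/
abbrev cx (Q : FinQuiver) (α : Q.V → ℕ) (c : Ix Q α) : Q.V := c.1

lemma prod_bh (α : Q.V → ℕ) (d : Q.V → ℂ) : ∏ b, d (bh Q α b) = ∏ x, d x ^ Nw Q α x := by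
  rw [Fintype.prod_sigma]
  simp only [bh, Finset.prod_const, Finset.card_univ, Fintype.card_fin, Nw,
    ← Finset.prod_pow_eq_pow_sum]
  rw [Finset.prod_comm]
  refine Finset.prod_congr rfl fun a _ => ?_
  rw [Finset.prod_eq_single (Q.h a)]
  · simp
  · intro x _ hx
    rw [if_neg (Ne.symm hx), pow_zero]
  · simp

lemma prod_cx (α : Q.V → ℕ) (d : Q.V → ℂ) : ∏ c, d (cx Q α c) = ∏ x, d x ^ α x := by
  rw [Fintype.prod_sigma]
  simp [cx]

theorem exists_Z {P : MvPolynomial (Co Q β) ℂ} {α : Q.V → ℕ} (hP : SemiInv P (Q.weightOf α))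
    {G : MvPolynomial (Co Q β ⊕ Xi Q β) ℂ} (hG : Good P (Nw Q α) G) (W : Q.Rep β)
    (hW : eval (ofRep W) P ≠ 0) (e : Rg β (cx Q α) ≃ Rg β (bh Q α)) :
    ∃ Z : Q.A ⊕ Q.V → Bi Q α → Ix Q α → ℂ,
      (∀ a b c, Z (Sum.inl a) b c ≠ 0 → Q.h a = Q.h b.1 ∧ Q.t a = c.1) ∧
      (∀ x b c, Z (Sum.inr x) b c ≠ 0 → x = Q.h b.1 ∧ x = c.1) ∧
      Matrix.det (Matrix.of fun c c' : Rg β (cx Q α) =>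
        ∑ a, Z a (e c).1 c'.1 * wt W (a, rgi (e c), rgi c')) ≠ 0 := by
  have hev : eval (wt W) (rename io G) = eval (ofRep W) P := by
    rw [eval_rename]
    have h1 : wt W ∘ io = pt W (fun _ => 1) := by
      funext v
      exact io_inj.extend_apply _ _ v
    rw [h1, hG _ _ (fun x => by rw [Matrix.det_one]; exact one_ne_zero)]
    have h2 : xinv W (fun _ => 1) = W := by
      funext a
      simp [xinv]
    rw [h2]
    simp
  obtain ⟨Z, hZ, hd⟩ := fft (A := Q.A ⊕ Q.V) (I := Ix Q β) (rgi (β := β) (vb := bh Q α))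
    (fun r => r.1) rgi_inj (rgi (β := β) (vb := cx Q α)) (fun r => r.1) rgi_inj e (rename io G)
    (wt W) (by
      intro ω ω' u v
      rw [det_Yt, det_Yt, hev, eval_rename]
      let Y : Sq Q β := fun x => Matrix.of fun p p' => Yt ω u ⟨x, p⟩ ⟨x, p'⟩
      let X : Sq Q β := fun x => Matrix.of fun q' q => Yt ω' v ⟨x, q⟩ ⟨x, q'⟩
      have h1 := good_sym hP hG W Y X
      rw [← prod_bh, ← prod_cx] at h1
      have e1 : ∀ b, (Y (bh Q α b)).det =
          (Matrix.of fun p' p => Yt ω u ⟨bh Q α b, p⟩ ⟨bh Q α b, p'⟩).det := fun b => by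
        rw [← Matrix.det_transpose]
        rfl
      simp only [e1] at h1
      refine Eq.trans ?_ h1
      congr 2
      funext z
      rcases z with ⟨a, p, q⟩ | ⟨x, p, q⟩
      · refine (sum_Yt2 ω u ω' v (Q.h a) (Q.t a) p q (fun i j => wt W (Sum.inl a, i, j))).trans ?_
        simp only [wt_inl]
        rfl
      · refine (sum_Yt2 ω u ω' v x x p q (fun i j => wt W (Sum.inr x, i, j))).trans ?_
        simp only [wt_inr]
        simp [pt, Matrix.mul_apply, Y, X]) (by rw [hev]; exact hW)
  refine ⟨Z, ?_, ?_, hd⟩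
  · intro a b c h
    obtain ⟨r, s, rfl, rfl, hv⟩ := hZ _ _ _ h
    have := vars_rename io G hv
    rw [Finset.mem_image] at this
    obtain ⟨z, _, hz⟩ := this
    rcases z with ⟨a', p, q⟩ | ⟨x, p, q⟩
    · simp only [io, Prod.mk.injEq, Sum.inl.injEq] at hz
      obtain ⟨rfl, h1, h2⟩ := hz
      exact ⟨congrArg Sigma.fst h1, congrArg Sigma.fst h2⟩
    · simp [io] at hz
  · intro a b c h
    obtain ⟨r, s, rfl, rfl, hv⟩ := hZ _ _ _ h
    have := vars_rename io G hv
    rw [Finset.mem_image] at this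
    obtain ⟨z, _, hz⟩ := this
    rcases z with ⟨a', p, q⟩ | ⟨x, p, q⟩
    · simp [io] at hz
    · simp only [io, Prod.mk.injEq, Sum.inr.injEq] at hz
      obtain ⟨rfl, h1, h2⟩ := hz
      exact ⟨congrArg Sigma.fst h1, congrArg Sigma.fst h2⟩
end QSI

namespace QSI
variable {Q : FinQuiver} {β : Q.V → ℕ}

lemma det_poly {m : Type} [Fintype m] [DecidableEq m] (M0 M1 : Matrix m m ℂ) :
    ∃ p : Polynomial ℂ, ∀ z, p.eval z = (M0 + z • M1).det := by
  refine ⟨(M0.map Polynomial.C + (Polynomial.X : Polynomial ℂ) • M1.map Polynomial.C).det,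
    fun z => ?_⟩
  rw [← Polynomial.coe_evalRingHom, RingHom.map_det]
  congr 1
  ext i j
  simp
  ring

lemma two_det {m n : Type} [Fintype m] [DecidableEq m] [Fintype n] [DecidableEq n]
    (M0 M1 : Matrix m m ℂ) (N0 N1 : Matrix n n ℂ) (h0 : M0.det ≠ 0) (h1 : (N0 + N1).det ≠ 0) :
    ∃ z : ℂ, (M0 + z • M1).det ≠ 0 ∧ (N0 + z • N1).det ≠ 0 := by
  obtain ⟨p, hp⟩ := det_poly M0 M1
  obtain ⟨q, hq⟩ := det_poly N0 N1
  have p0 : p ≠ 0 := by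
    rintro rfl
    have := hp 0
    simp at this
    exact h0 this.symm
  have q0 : q ≠ 0 := by
    rintro rfl
    have := hq 1
    simp at this
    exact h1 this.symm
  by_contra hcon
  push Not at hcon
  apply mul_ne_zero p0 q0
  apply Polynomial.funext
  intro z
  rw [Polynomial.eval_mul, Polynomial.eval_zero, hp, hq]
  by_cases h : (M0 + z • M1).det = 0
  · rw [h, zero_mul]
  · rw [hcon z h, mul_zero]

/-- global matrix of a homomorphism -/
noncomputable def phg {α : Q.V → ℕ} (φ : ∀ x : Q.V, Matrix (Fin (β x)) (Fin (α x)) ℂ)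
    (i : Ix Q β) (c : Ix Q α) : ℂ :=
  ∑ q, if (⟨c.1, q⟩ : Ix Q β) = i then φ c.1 q c.2 else 0

lemma phg_eq {α : Q.V → ℕ} (φ : ∀ x : Q.V, Matrix (Fin (β x)) (Fin (α x)) ℂ)
    (x : Q.V) (p : Fin (β x)) (l : Fin (α x)) : phg φ ⟨x, p⟩ ⟨x, l⟩ = φ x p l := by
  simp [phg]

lemma phg_ne {α : Q.V → ℕ} (φ : ∀ x : Q.V, Matrix (Fin (β x)) (Fin (α x)) ℂ)
    (i : Ix Q β) (c : Ix Q α) (h : i.1 ≠ c.1) : phg φ i c = 0 := by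
  refine Finset.sum_eq_zero fun q _ => if_neg ?_
  rintro rfl
  exact h rfl

lemma sum_phg {α : Q.V → ℕ} (φ : ∀ x : Q.V, Matrix (Fin (β x)) (Fin (α x)) ℂ)
    (x : Q.V) (p : Fin (β x)) (f : Ix Q α → ℂ) :
    ∑ c, phg φ ⟨x, p⟩ c * f c = ∑ l, φ x p l * f ⟨x, l⟩ := by
  rw [Fintype.sum_sigma, Finset.sum_eq_single x]
  · simp only [phg_eq]
  · intro y _ hy
    refine Finset.sum_eq_zero fun l _ => ?_
    rw [phg_ne _ _ _ (fun h => hy h.symm), zero_mul]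
  · simp

/-- partial evaluation -/
noncomputable def Tt {α : Q.V → ℕ} (W : Q.Rep β)
    (φ : ∀ x : Q.V, Matrix (Fin (β x)) (Fin (α x)) ℂ) (a : Q.A ⊕ Q.V) (i : Ix Q β) (c : Ix Q α) : ℂ :=
  ∑ q, wt W (a, i, ⟨c.1, q⟩) * φ c.1 q c.2

lemma Tt_inr {α : Q.V → ℕ} (W : Q.Rep β)
    (φ : ∀ x : Q.V, Matrix (Fin (β x)) (Fin (α x)) ℂ) (x : Q.V) (i : Ix Q β) (c : Ix Q α)
    (h1 : x = i.1) (h2 : x = c.1) : Tt W φ (Sum.inr x) i c = phg φ i c := by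
  obtain ⟨y, p⟩ := i
  obtain ⟨z, l⟩ := c
  simp only at h1 h2
  subst h1
  subst h2
  simp [Tt, wt_inr, phg_eq]

lemma Tt_inl {α : Q.V → ℕ} (W : Q.Rep β) (V : Q.Rep α)
    (φ : ∀ x : Q.V, Matrix (Fin (β x)) (Fin (α x)) ℂ) (hφ : Q.IsHom V W φ)
    (D : Bi Q α → Ix Q α → ℂ) (hV : ∀ a l k, V a l k = - D ⟨a, k⟩ ⟨Q.h a, l⟩)
    (a : Q.A) (i : Ix Q β) (k : Fin (α (Q.t a)))
    (h1 : Q.h a = i.1) : Tt W φ (Sum.inl a) i ⟨Q.t a, k⟩ = - ∑ c, phg φ i c * D ⟨a, k⟩ c := by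
  obtain ⟨y, p⟩ := i
  simp only at h1
  subst h1
  rw [sum_phg]
  simp only [Tt, wt_inl]
  have := congrFun (congrFun (hφ a) p) k
  rw [Matrix.mul_apply, Matrix.mul_apply] at this
  rw [← this, ← Finset.sum_neg_distrib]
  refine Finset.sum_congr rfl fun l _ => ?_
  rw [hV]
  ring

theorem hom_zero {α : Q.V → ℕ} (W : Q.Rep β) (e : Rg β (cx Q α) ≃ Rg β (bh Q α))
    (Z : Q.A ⊕ Q.V → Bi Q α → Ix Q α → ℂ)
    (hZ1 : ∀ a b c, Z (Sum.inl a) b c ≠ 0 → Q.h a = Q.h b.1 ∧ Q.t a = c.1)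
    (hZ2 : ∀ x b c, Z (Sum.inr x) b c ≠ 0 → x = Q.h b.1 ∧ x = c.1)
    (hd : Matrix.det (Matrix.of fun c c' : Rg β (cx Q α) =>
        ∑ a, Z a (e c).1 c'.1 * wt W (a, rgi (e c), rgi c')) ≠ 0)
    (hA : Matrix.det (Matrix.of fun b b' : Bi Q α => Z (Sum.inl b'.1) b ⟨Q.t b'.1, b'.2⟩) ≠ 0) :
    ∃ V : Q.Rep α, Q.homSpace V W = ⊥ := by
  set Â : Matrix (Bi Q α) (Bi Q α) ℂ :=
    Matrix.of fun b b' : Bi Q α => Z (Sum.inl b'.1) b ⟨Q.t b'.1, b'.2⟩ with hÂ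
  let B : Matrix (Bi Q α) (Ix Q α) ℂ := Matrix.of fun b c => ∑ x, Z (Sum.inr x) b c
  let D : Matrix (Bi Q α) (Ix Q α) ℂ := Â⁻¹ * B
  have hD : Â * D = B := by
    simp only [D]
    rw [← Matrix.mul_assoc, Matrix.mul_nonsing_inv _ hA.isUnit, Matrix.one_mul]
  let V : Q.Rep α := fun a => Matrix.of fun l k => - D ⟨a, k⟩ ⟨Q.h a, l⟩
  refine ⟨V, ?_⟩
  rw [eq_bot_iff]
  intro φ hφ
  have hφ' : Q.IsHom V W φ := hφ
  let ψ : Rg β (cx Q α) → ℂ := fun c => φ c.1.1 c.2 c.1.2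
  have hψ : ψ = 0 := by
    apply Matrix.eq_zero_of_mulVec_eq_zero hd
    funext r
    simp only [Matrix.mulVec, dotProduct, Matrix.of_apply, Pi.zero_apply]
    obtain ⟨b, p⟩ := e r
    have s1 : ∑ c : Rg β (cx Q α), (∑ a, Z a b c.1 * wt W (a, rgi ⟨b, p⟩, rgi c)) * ψ c =
        ∑ a, ∑ c, Z a b c * Tt W φ a ⟨Q.h b.1, p⟩ c := by
      rw [Fintype.sum_sigma, Finset.sum_comm]
      refine Finset.sum_congr rfl fun c _ => ?_
      simp only [Finset.sum_mul, Tt, Finset.mul_sum]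
      rw [Finset.sum_comm]
      refine Finset.sum_congr rfl fun a _ => Finset.sum_congr rfl fun q _ => ?_
      simp only [ψ, rgi, mul_assoc]
    refine s1.trans ?_
    rw [Fintype.sum_sum_type]
    have s2 : ∑ a, ∑ c, Z (Sum.inl a) b c * Tt W φ (Sum.inl a) ⟨Q.h b.1, p⟩ c =
        - ∑ c, phg φ ⟨Q.h b.1, p⟩ c * B b c := by
      have t1 : ∀ a, ∑ c, Z (Sum.inl a) b c * Tt W φ (Sum.inl a) ⟨Q.h b.1, p⟩ c =
          ∑ k, Â b ⟨a, k⟩ * (- ∑ c, phg φ ⟨Q.h b.1, p⟩ c * D ⟨a, k⟩ c) := by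
        intro a
        rw [Fintype.sum_sigma, Finset.sum_eq_single (Q.t a)]
        · refine Finset.sum_congr rfl fun k _ => ?_
          simp only [hÂ, Matrix.of_apply]
          by_cases h : Z (Sum.inl a) b ⟨Q.t a, k⟩ = 0
          · rw [h, zero_mul, zero_mul]
          · rw [Tt_inl W V φ hφ' D (fun _ _ _ => rfl) a _ k (hZ1 _ _ _ h).1]
        · intro x _ hx
          refine Finset.sum_eq_zero fun k _ => ?_
          by_cases h : Z (Sum.inl a) b ⟨x, k⟩ = 0
          · rw [h, zero_mul]
          · exact absurd (hZ1 _ _ _ h).2.symm hx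
        · simp
      simp only [t1]
      rw [← Fintype.sum_sigma' (fun a k => Â b ⟨a, k⟩ *
        (- ∑ c, phg φ ⟨Q.h b.1, p⟩ c * D ⟨a, k⟩ c))]
      simp only [mul_neg, Finset.sum_neg_distrib, Finset.mul_sum]
      rw [Finset.sum_comm]
      congr 1
      refine Finset.sum_congr rfl fun c _ => ?_
      rw [← hD, Matrix.mul_apply, Finset.mul_sum]
      refine Finset.sum_congr rfl fun b' _ => ?_
      ring
    have s3 : ∑ x, ∑ c, Z (Sum.inr x) b c * Tt W φ (Sum.inr x) ⟨Q.h b.1, p⟩ c =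
        ∑ c, phg φ ⟨Q.h b.1, p⟩ c * B b c := by
      rw [Finset.sum_comm]
      refine Finset.sum_congr rfl fun c _ => ?_
      simp only [B, Matrix.of_apply, Finset.mul_sum]
      refine Finset.sum_congr rfl fun x _ => ?_
      by_cases h : Z (Sum.inr x) b c = 0
      · rw [h, zero_mul, mul_zero]
      · rw [Tt_inr W φ x _ c (hZ2 _ _ _ h).1 (hZ2 _ _ _ h).2, mul_comm]
    rw [s2, s3, neg_add_cancel]
  rw [Submodule.mem_bot]
  funext x
  ext q l
  exact congrFun hψ ⟨⟨x, l⟩, q⟩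

theorem exists_V {α : Q.V → ℕ} (W : Q.Rep β) (e : Rg β (cx Q α) ≃ Rg β (bh Q α))
    (Z : Q.A ⊕ Q.V → Bi Q α → Ix Q α → ℂ)
    (hZ1 : ∀ a b c, Z (Sum.inl a) b c ≠ 0 → Q.h a = Q.h b.1 ∧ Q.t a = c.1)
    (hZ2 : ∀ x b c, Z (Sum.inr x) b c ≠ 0 → x = Q.h b.1 ∧ x = c.1)
    (hd : Matrix.det (Matrix.of fun c c' : Rg β (cx Q α) =>
        ∑ a, Z a (e c).1 c'.1 * wt W (a, rgi (e c), rgi c')) ≠ 0) :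
    ∃ V : Q.Rep α, Q.homSpace V W = ⊥ := by
  let Zc : Q.A ⊕ Q.V → Bi Q α → Ix Q α → ℂ := fun a b c =>
    Sum.elim (fun a => if a = b.1 ∧ c = ⟨Q.t b.1, b.2⟩ then 1 else 0) (fun _ => 0) a
  have hZc : (Matrix.of fun b b' : Bi Q α => Zc (Sum.inl b'.1) b ⟨Q.t b'.1, b'.2⟩) = 1 := by
    ext ⟨a, k⟩ ⟨a', k'⟩
    simp only [Zc, Matrix.of_apply, Sum.elim_inl, Matrix.one_apply]
    refine if_congr ?_ rfl rfl
    constructor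
    · rintro ⟨rfl, h⟩
      simp only [Sigma.mk.injEq, heq_eq_eq, true_and] at h
      rw [h]
    · intro h
      simp only [Sigma.mk.injEq] at h
      obtain ⟨rfl, h⟩ := h
      rw [eq_of_heq h]
      exact ⟨rfl, rfl⟩
  obtain ⟨z, h1, h2⟩ := two_det (Matrix.of fun c c' : Rg β (cx Q α) =>
        ∑ a, Z a (e c).1 c'.1 * wt W (a, rgi (e c), rgi c'))
      (Matrix.of fun c c' : Rg β (cx Q α) =>
        ∑ a, (Zc a (e c).1 c'.1 - Z a (e c).1 c'.1) * wt W (a, rgi (e c), rgi c'))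
      (Matrix.of fun b b' : Bi Q α => Z (Sum.inl b'.1) b ⟨Q.t b'.1, b'.2⟩)
      (1 - Matrix.of fun b b' : Bi Q α => Z (Sum.inl b'.1) b ⟨Q.t b'.1, b'.2⟩)
      hd (by rw [add_sub_cancel, Matrix.det_one]; exact one_ne_zero)
  refine hom_zero W e (fun a b c => Z a b c + z * (Zc a b c - Z a b c)) ?_ ?_ ?_ ?_
  · intro a b c h
    by_cases hz : Z (Sum.inl a) b c = 0
    · have : Zc (Sum.inl a) b c ≠ 0 := by
        intro h0
        rw [hz, h0] at h
        simp at h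
      simp only [Zc, Sum.elim_inl, ne_eq, ite_eq_right_iff, one_ne_zero, imp_false, not_not] at this
      obtain ⟨rfl, rfl⟩ := this
      exact ⟨rfl, rfl⟩
    · exact hZ1 _ _ _ hz
  · intro x b c h
    apply hZ2
    intro hz
    rw [hz] at h
    simp [Zc] at h
  · convert h1 using 2
    ext c c'
    simp only [Matrix.add_apply, Matrix.smul_apply, Matrix.of_apply, smul_eq_mul, Finset.mul_sum,
      ← Finset.sum_add_distrib]
    refine Finset.sum_congr rfl fun a _ => ?_
    ring
  · rw [← hZc] at h2
    convert h2 using 2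
    ext b b'
    simp only [Matrix.add_apply, Matrix.smul_apply, Matrix.of_apply, smul_eq_mul, Matrix.sub_apply]
end QSI

namespace QSI
open MvPolynomial
variable {Q : FinQuiver} {α β : Q.V → ℕ}

/-- the defining map of the homomorphism space -/
def Lf {K : Type} [CommRing K] (V : ∀ a : Q.A, Matrix (Fin (α (Q.h a))) (Fin (α (Q.t a))) K)
    (W : ∀ a : Q.A, Matrix (Fin (β (Q.h a))) (Fin (β (Q.t a))) K) :
    (Rg β (cx Q α) → K) →ₗ[K] (Rg β (bh Q α) → K) where
  toFun ψ r := ∑ l, ψ ⟨⟨Q.h r.1.1, l⟩, r.2⟩ * V r.1.1 l r.1.2 -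
    ∑ q, W r.1.1 r.2 q * ψ ⟨⟨Q.t r.1.1, r.1.2⟩, q⟩
  map_add' ψ ψ' := by
    funext r
    simp only [Pi.add_apply, add_mul, mul_add, Finset.sum_add_distrib]
    ring
  map_smul' c ψ := by
    funext r
    simp only [Pi.smul_apply, smul_eq_mul, RingHom.id_apply, mul_sub, Finset.mul_sum]
    congr 1
    · exact Finset.sum_congr rfl fun l _ => by ring
    · exact Finset.sum_congr rfl fun l _ => by ring

/-- its square matrix -/
def Lm (e : Rg β (cx Q α) ≃ Rg β (bh Q α)) {K : Type} [CommRing K]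
    (V : ∀ a : Q.A, Matrix (Fin (α (Q.h a))) (Fin (α (Q.t a))) K)
    (W : ∀ a : Q.A, Matrix (Fin (β (Q.h a))) (Fin (β (Q.t a))) K) :
    Matrix (Rg β (cx Q α)) (Rg β (cx Q α)) K :=
  Matrix.of fun c c' => Lf V W (fun d => if d = c' then 1 else 0) (e c)

lemma Lm_mulVec (e : Rg β (cx Q α) ≃ Rg β (bh Q α)) {K : Type} [CommRing K]
    (V : ∀ a : Q.A, Matrix (Fin (α (Q.h a))) (Fin (α (Q.t a))) K)
    (W : ∀ a : Q.A, Matrix (Fin (β (Q.h a))) (Fin (β (Q.t a))) K) (ψ : Rg β (cx Q α) → K)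
    (c : Rg β (cx Q α)) : (Lm e V W).mulVec ψ c = Lf V W ψ (e c) := by
  have h : ψ = ∑ c', ψ c' • (fun d => if d = c' then (1 : K) else 0) := by
    funext d
    simp [Finset.sum_apply]
  conv_rhs => rw [h]
  rw [map_sum, Finset.sum_apply]
  simp only [Matrix.mulVec, dotProduct, map_smul, Pi.smul_apply, smul_eq_mul, Lm, Matrix.of_apply]
  exact Finset.sum_congr rfl fun _ _ => mul_comm _ _

lemma Lm_map (e : Rg β (cx Q α) ≃ Rg β (bh Q α)) {K K' : Type} [CommRing K] [CommRing K']
    (f : K →+* K')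
    (V : ∀ a : Q.A, Matrix (Fin (α (Q.h a))) (Fin (α (Q.t a))) K)
    (W : ∀ a : Q.A, Matrix (Fin (β (Q.h a))) (Fin (β (Q.t a))) K) :
    f (Lm e V W).det = (Lm e (fun a => (V a).map f) (fun a => (W a).map f)).det := by
  rw [RingHom.map_det]
  congr 1
  ext c c'
  simp only [RingHom.mapMatrix_apply, Matrix.map_apply, Lm, Matrix.of_apply, Lf, LinearMap.coe_mk,
    AddHom.coe_mk, map_sub, map_sum, map_mul]
  congr 1
  · refine Finset.sum_congr rfl fun l _ => ?_
    congr 1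
    split_ifs <;> simp
  · refine Finset.sum_congr rfl fun l _ => ?_
    congr 1
    split_ifs <;> simp

lemma block_mulVec {B : Type} [Fintype B] [DecidableEq B] {F : B → Type} [∀ b, Fintype (F b)]
    (M : ∀ b, Matrix (F b) (F b) ℂ) (ψ : (b : B) × F b → ℂ) (b : B) (p : F b) :
    (Matrix.blockDiagonal' M).mulVec ψ ⟨b, p⟩ = ∑ p', M b p p' * ψ ⟨b, p'⟩ := by
  simp only [Matrix.mulVec, dotProduct]
  rw [Fintype.sum_sigma, Finset.sum_eq_single b]
  · simp only [Matrix.blockDiagonal'_apply_eq]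
  · intro b' _ hb
    refine Finset.sum_eq_zero fun p' _ => ?_
    rw [Matrix.blockDiagonal'_apply_ne _ _ _ (Ne.symm hb), zero_mul]
  · simp

lemma Lf_act (V : Q.Rep α) (W : Q.Rep β) (g : Q.GLb β) (ψ : Rg β (cx Q α) → ℂ) :
    Lf V (Q.invAct g W) ψ = (Matrix.blockDiagonal' fun b : Bi Q α => ((g (bh Q α b))⁻¹).val).mulVec
      (Lf V W ((Matrix.blockDiagonal' fun c : Ix Q α => (g (cx Q α c)).val).mulVec ψ)) := by
  funext ⟨⟨a, k⟩, p⟩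
  rw [block_mulVec]
  let Ψ : ∀ x : Q.V, Matrix (Fin (β x)) (Fin (α x)) ℂ := fun x =>
    Matrix.of fun q l => ψ ⟨⟨x, l⟩, q⟩
  have l1 : Lf V (Q.invAct g W) ψ ⟨⟨a, k⟩, p⟩ =
      (Ψ (Q.h a) * V a - ((g (Q.h a))⁻¹).val * W a * (g (Q.t a)).val * Ψ (Q.t a)) p k := rfl
  have l2 : ∀ p', Lf V W ((Matrix.blockDiagonal' fun c : Ix Q α => (g (cx Q α c)).val).mulVec ψ)
      ⟨⟨a, k⟩, p'⟩ = ((g (Q.h a)).val * Ψ (Q.h a) * V a - W a * ((g (Q.t a)).val * Ψ (Q.t a))) p' k := by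
    intro p'
    simp only [Lf, LinearMap.coe_mk, AddHom.coe_mk, block_mulVec]
    rfl
  simp only [l2]
  rw [l1]
  have l3 : Ψ (Q.h a) * V a - ((g (Q.h a))⁻¹).val * W a * (g (Q.t a)).val * Ψ (Q.t a) =
      ((g (Q.h a))⁻¹).val * ((g (Q.h a)).val * Ψ (Q.h a) * V a -
        W a * ((g (Q.t a)).val * Ψ (Q.t a))) := by
    rw [Matrix.mul_sub]
    simp only [← Matrix.mul_assoc]
    rw [Units.inv_mul, Matrix.one_mul]
  rw [l3]
  rfl

lemma Lm_act (e : Rg β (cx Q α) ≃ Rg β (bh Q α)) (V : Q.Rep α) (W : Q.Rep β) (g : Q.GLb β) :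
    (Lm e V (Q.invAct g W)).det = Q.detWeight (Q.weightOf α) g * (Lm e V W).det := by
  have h : Lm e V (Q.invAct g W) =
      ((Matrix.blockDiagonal' fun b : Bi Q α => ((g (bh Q α b))⁻¹).val).submatrix e e) *
      (Lm e V W) * (Matrix.blockDiagonal' fun c : Ix Q α => (g (cx Q α c)).val) := by
    apply Matrix.mulVec_injective
    funext ψ
    funext c
    refine (Lm_mulVec e V (Q.invAct g W) ψ c).trans
      ((congrFun (Lf_act V W g ψ) (e c)).trans ?_)
    rw [← Matrix.mulVec_mulVec, ← Matrix.mulVec_mulVec,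
      Matrix.submatrix_mulVec_equiv]
    simp only [Function.comp_apply]
    congr 2
    funext r
    refine Eq.symm ((Lm_mulVec e V W _ (e.symm r)).trans ?_)
    rw [Equiv.apply_symm_apply]
  rw [h, Matrix.det_mul, Matrix.det_mul, Matrix.det_submatrix_equiv_self, det_blocks, det_blocks,
    prod_bh α (fun x => ((g x)⁻¹).val.det), prod_cx α (fun x => (g x).val.det), mul_right_comm]
  congr 1
  rw [FinQuiver.detWeight, ← Finset.prod_mul_distrib]
  refine Finset.prod_congr rfl fun x _ => ?_
  have h1 : ((g x)⁻¹).val.det * (g x).val.det = 1 := by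
    rw [← Matrix.det_mul, Units.inv_mul, Matrix.det_one]
  have h0 : (g x).val.det ≠ 0 := right_ne_zero_of_mul_eq_one h1
  rw [eq_inv_of_mul_eq_one_left h1, weightOf_eq, zpow_sub₀ h0, zpow_natCast, zpow_natCast, inv_pow]
  field_simp

theorem exists_semi (e : Rg β (cx Q α) ≃ Rg β (bh Q α)) (V : Q.Rep α) (W : Q.Rep β)
    (hVW : Q.homSpace V W = ⊥) :
    ∃ P : MvPolynomial (Co Q β) ℂ, P ≠ 0 ∧ SemiInv P (Q.weightOf α) := by
  let P : MvPolynomial (Co Q β) ℂ :=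
    (Lm e (fun a => (V a).map C) (fun a => Matrix.of fun p q => X ⟨a, p, q⟩)).det
  have hP : ∀ W' : Q.Rep β, eval (ofRep W') P = (Lm e V W').det := by
    intro W'
    rw [Lm_map]
    congr 2
    · funext a
      ext i j
      simp
    · funext a
      ext i j
      simp [ofRep]
  refine ⟨P, ?_, fun g W' => by rw [hP, hP, Lm_act]⟩
  intro h0
  have h1 := hP W
  rw [h0, map_zero] at h1
  obtain ⟨ψ, hψ0, hψ⟩ := Matrix.exists_mulVec_eq_zero_iff.2 h1.symm
  apply hψ0
  let Ψ : ∀ x : Q.V, Matrix (Fin (β x)) (Fin (α x)) ℂ := fun x =>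
    Matrix.of fun q l => ψ ⟨⟨x, l⟩, q⟩
  have hm : Ψ ∈ Q.homSpace V W := by
    intro a
    ext p k
    have := (Lm_mulVec e V W ψ (e.symm ⟨⟨a, k⟩, p⟩)).symm.trans (congrFun hψ (e.symm ⟨⟨a, k⟩, p⟩))
    rw [Equiv.apply_symm_apply] at this
    exact sub_eq_zero.1 this
  rw [hVW, Submodule.mem_bot] at hm
  funext ⟨⟨x, l⟩, q⟩
  exact congrFun (congrFun (congrFun hm x) q) l

lemma euler_eq : Q.euler (natToInt α) (natToInt β) =
    (Fintype.card (Rg β (cx Q α)) : ℤ) - Fintype.card (Rg β (bh Q α)) := by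
  simp only [Rg, Fintype.card_sigma, Fintype.card_fin, FinQuiver.euler, natToInt]
  rw [Fintype.sum_sigma, Fintype.sum_sigma]
  simp [cx, bh]

lemma sum_weightOf : ∑ x, Q.weightOf α x * (β x : ℤ) = Q.euler (natToInt α) (natToInt β) := by
  simp only [FinQuiver.weightOf, FinQuiver.euler, natToInt, sub_mul, Finset.sum_sub_distrib,
    Finset.sum_mul]
  congr 1
  rw [Finset.sum_comm]
  refine Finset.sum_congr rfl fun a _ => ?_
  simp [ite_mul]

theorem main (hacyc : Q.Acyclic) (α β : Q.V → ℕ) :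
    Q.circ α β ≠ 0 ↔ (Q.euler (natToInt α) (natToInt β) = 0 ∧
      ∃ (V : Q.Rep α) (W : Q.Rep β), Q.homSpace V W = ⊥) := by
  rw [circ_ne_zero hacyc]
  constructor
  · rintro ⟨P, h0, hP⟩
    have he : Q.euler (natToInt α) (natToInt β) = 0 := by
      rw [← sum_weightOf]
      exact sum_weight hP h0
    refine ⟨he, ?_⟩
    rw [euler_eq, sub_eq_zero] at he
    have e := Fintype.equivOfCardEq (Nat.cast_injective he)
    obtain ⟨G, hG⟩ := exists_good hP (Nw Q α) (rowdeg_le hacyc α hP)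
    obtain ⟨x, hx⟩ : ∃ x, eval x P ≠ 0 := by
      by_contra hcon
      push Not at hcon
      exact h0 (MvPolynomial.funext fun x => by rw [hcon x, map_zero])
    obtain ⟨Z, z1, z2, hd⟩ := exists_Z hP hG (toRep x) hx e
    obtain ⟨V, hV⟩ := exists_V (toRep x) e Z z1 z2 hd
    exact ⟨V, toRep x, hV⟩
  · rintro ⟨he, V, W, hVW⟩
    rw [euler_eq, sub_eq_zero] at he
    exact exists_semi (Fintype.equivOfCardEq (Nat.cast_injective he)) V W hVW
end QSI

/-- For dimension vectors `α, β` of a finite, connected, acyclic quiver `Q`,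
`(α∘β)_Q ≠ 0` iff `⟨α,β⟩ = 0` and there exist representations `V, W` of dimension vectors
`α, β` with `Hom_Q(V,W) = 0`. -/
theorem circ_ne_zero_iff
    (Q : FinQuiver) (hconn : Q.Connected) (hacyc : Q.Acyclic)
    (α β : Q.V → ℕ) :
    Q.circ α β ≠ 0 ↔
      (Q.euler (natToInt α) (natToInt β) = 0 ∧
        ∃ (V : Q.Rep α) (W : Q.Rep β), Q.homSpace V W = ⊥) := by
  exact QSI.main hacyc α β
end

section
/- The sequence ℰ = (δ₁, …, δ_m, e_{y₁}, …, e_{y_n}) is a quiver exceptional sequence for the quiver 𝒯, and the associated quiver 𝒯(ℰ) — with vertex set {1, …, m+n} and −⟨ε_i, ε_j⟩ arrows from vertex i to vertex j for the members ε_i of ℰ — is isomorphic to the p-complete bipartite quiver Q^p_{m,n}; in particular ⟨δ_i, δ_i⟩ = 1 = ⟨e_{y_j}, e_{y_j}⟩, ⟨δ_i, δ_{i'}⟩ = 0 for i ≠ i', ⟨e_{y_j}, e_{y_{j'}}⟩ = 0 for j ≠ j', ⟨e_{y_j}, δ_i⟩ = 0, and ⟨δ_i, e_{y_j}⟩ =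 −p for all i ∈ [m], j ∈ [n]. -/
/-- The vertices of the quiver `𝒯`: sources `x₁,…,x_{m+p}`, middle vertices `x₀, y₀`,
and sinks `y₁,…,y_n`. -/
inductive TVert (m p n : ℕ) : Type where
  | x : Fin (m + p) → TVert m p n
  | x0 : TVert m p n
  | y0 : TVert m p n
  | y : Fin n → TVert m p n
  deriving DecidableEq, Fintype

/-- The quiver `𝒯` with arrows `x_ℓ → x₀` (`ℓ ∈ [m+p]`), `x₀ → y₀`, `y₀ → y_j` (`j ∈ [n]`). -/
def Tquiv (m p n : ℕ) : FinQuiver where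
  V := TVert m p n
  A := Fin (m + p) ⊕ Unit ⊕ Fin n
  t := Sum.elim (fun ℓ => TVert.x ℓ) (Sum.elim (fun _ => TVert.x0) (fun _ => TVert.y0))
  h := Sum.elim (fun _ => TVert.x0) (Sum.elim (fun _ => TVert.y0) (fun j => TVert.y j))

/-- The dimension vector `δᵢ` of `𝒯`: value `p+1` at `x₀`, `p` at `y₀`, `1` at `xᵢ` and at
`x_{m+1},…,x_{m+p}`, and `0` elsewhere. -/
def deltaT (m p n : ℕ) (i : Fin m) : TVert m p n → ℕ
  | .x ℓ => if ℓ.val = i.val ∨ m ≤ ℓ.val then 1 else 0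
  | .x0 => p + 1
  | .y0 => p
  | .y _ => 0

/-- The simple dimension vector `e_{y_j}` of `𝒯`. -/
def eyT (m p n : ℕ) (j : Fin n) : TVert m p n → ℕ
  | .y j' => if j' = j then 1 else 0
  | _ => 0

/-- The sequence `ℰ = (δ₁, …, δ_m, e_{y₁}, …, e_{y_n})` of dimension vectors of `𝒯`. -/
def seqE (m p n : ℕ) : Fin (m + n) → (TVert m p n → ℕ) :=
  fun i => if h : i.val < m then deltaT m p n ⟨i.val, h⟩
    else eyT m p n ⟨i.val - m, by have := i.isLt; omega⟩


/-! ### Helper lemmas -/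

/-- Multivariate polynomial that is quasi-homogeneous as a function is homogeneous. -/
lemma eval_homog_aux {ι : Type} (P : MvPolynomial ι ℂ) (w : ι → ℂ) (d : ℤ)
    (h : ∀ t : ℂ, t ≠ 0 → MvPolynomial.eval (fun i => t * w i) P
      = t ^ d * MvPolynomial.eval w P) :
    (d < 0 → MvPolynomial.eval w P = 0) ∧
    (0 ≤ d → MvPolynomial.eval w P = MvPolynomial.eval w (MvPolynomial.homogeneousComponent d.toNat P)) := by
  classical
  set c := MvPolynomial.eval w P with hc
  let q : Polynomial ℂ := ∑ k ∈ Finset.range (P.totalDegree + 1),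
    Polynomial.monomial k (MvPolynomial.eval w (MvPolynomial.homogeneousComponent k P))
  have hq : ∀ t : ℂ, q.eval t = MvPolynomial.eval (fun i => t * w i) P := by
    intro t
    conv_rhs => rw [← MvPolynomial.sum_homogeneousComponent P]
    simp only [q, Polynomial.eval_finsetSum, map_sum, Polynomial.eval_monomial]
    refine Finset.sum_congr rfl fun k _ => ?_
    rw [MvPolynomial.eval_eq, MvPolynomial.eval_eq, Finset.sum_mul]
    refine Finset.sum_congr rfl fun e he => ?_
    have hdeg := (MvPolynomial.homogeneousComponent_isHomogeneous k P)
      (MvPolynomial.mem_support_iff.mp he)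
    have : ∑ i ∈ e.support, e i = k := by
      rw [← hdeg, Finsupp.weight_apply]; simp [Finsupp.sum]
    simp only [mul_pow, Finset.prod_mul_distrib, Finset.prod_pow_eq_pow_sum, this]
    ring
  have hcoef : ∀ k, q.coeff k = MvPolynomial.eval w (MvPolynomial.homogeneousComponent k P) := by
    intro k
    simp only [q, Polynomial.finsetSum_coeff, Polynomial.coeff_monomial]
    rw [Finset.sum_ite_eq' (Finset.range (P.totalDegree + 1)) k]
    by_cases hk : k ∈ Finset.range (P.totalDegree + 1)
    · simp only [hk, if_true]
    · simp only [hk, if_false]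
      rw [MvPolynomial.homogeneousComponent_eq_zero]
      · simp
      · have := mt Finset.mem_range.mpr hk
        omega
  have inf : ({0}ᶜ : Set ℂ).Infinite := Set.Finite.infinite_compl (Set.finite_singleton 0)
  refine ⟨fun hd => ?_, fun hd => ?_⟩
  rotate_left
  · obtain ⟨D, rfl⟩ := Int.eq_ofNat_of_zero_le hd
    have : q = Polynomial.monomial D c := by
      refine Polynomial.eq_of_infinite_eval_eq _ _ (inf.mono ?_)
      intro t ht
      have ht' : t ≠ 0 := by simpa using ht
      simp [hq t, h t ht', mul_comm]
    have h2 := hcoef D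
    rw [this] at h2
    simpa using h2
  · obtain ⟨D, hD⟩ := Int.eq_ofNat_of_zero_le (by omega : 0 ≤ -d)
    have hD0 : D ≠ 0 := by omega
    have : q * Polynomial.X ^ D = Polynomial.C c := by
      refine Polynomial.eq_of_infinite_eval_eq _ _ (inf.mono ?_)
      intro t ht
      have ht' : t ≠ 0 := by simpa using ht
      have hd' : d = -(D : ℤ) := by omega
      simp only [Set.mem_ofPred_eq, Polynomial.eval_mul, hq t, h t ht', Polynomial.eval_pow,
        Polynomial.eval_X, Polynomial.eval_C, hd', zpow_neg, zpow_natCast]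
      field_simp
    have h2 := congrArg (Polynomial.eval 0) this
    simpa [hD0] using h2.symm

namespace FinQuiver

/-- The evaluation of polynomials as functions on the representation space. -/
noncomputable def evalLin (Q : FinQuiver) (β : Q.V → ℕ) :
    MvPolynomial ((a : Q.A) × (Fin (β (Q.h a)) × Fin (β (Q.t a)))) ℂ →ₗ[ℂ] (Q.Rep β → ℂ) where
  toFun P := fun W => MvPolynomial.eval (fun i => W i.1 i.2.1 i.2.2) P
  map_add' P R := by ext W; simp
  map_smul' c P := by ext W; simp

lemma SIw_finite (Q : FinQuiver) (β : Q.V → ℕ) (σ : Q.V → ℤ) (ht : Q.V → ℕ)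
    (hh : ∀ a, ht (Q.t a) = ht (Q.h a) + 1) : Module.Finite ℂ (Q.SIw β σ) := by
  classical
  set d : ℤ := ∑ x, (ht x : ℤ) * β x * σ x with hd
  have key : Q.SIw β σ ≤ Submodule.map (Q.evalLin β)
      (MvPolynomial.restrictTotalDegree _ ℂ d.toNat) := by
    rintro f ⟨⟨P, hP⟩, hf⟩
    have hs : ∀ (t : ℂ), t ≠ 0 → ∀ W : Q.Rep β,
        f (fun a => t • W a) = t ^ d * f W := by
      intro t t0 W
      let g : Q.GLb β := fun x => Units.map (Matrix.scalar (Fin (β x))).toMonoidHom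
        (Units.mk0 (t ^ ht x) (pow_ne_zero _ t0))
      have h1 := hf g W
      have h2 : Q.invAct g W = fun a => t • W a := by
        funext a
        ext r c
        simp only [invAct, g, ← map_inv]
        simp [Matrix.scalar_apply, hh a]
        field_simp
        ring
      have h3 : Q.detWeight σ g = t ^ d := by
        simp only [detWeight, g, hd]
        have hs : ∀ (s : Finset Q.V) (e : Q.V → ℤ), t ^ (∑ x ∈ s, e x) = ∏ x ∈ s, t ^ e x := by
          intro s e
          induction s using Finset.induction_on with
          | empty => simp
          | insert a s ha ih => rw [Finset.sum_insert ha, Finset.prod_insert ha, zpow_add₀ t0, ih]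
        rw [hs]
        refine Finset.prod_congr rfl fun x _ => ?_
        simp [Matrix.scalar_apply, zpow_mul]
      rw [h2, h3] at h1
      exact h1
    have haux : ∀ W : Q.Rep β, _ := fun W => eval_homog_aux P (fun i => W i.1 i.2.1 i.2.2) d
      (fun t t0 => by
        have := hs t t0 W
        have e1 := hP (fun a => t • W a)
        rw [hP W] at this
        rw [← this, e1]
        rfl)
    rcases lt_or_ge d 0 with hd0 | hd0
    · have hz : f = 0 := by
        funext W
        rw [hP W]; exact (haux W).1 hd0
      rw [hz]; exact Submodule.zero_mem _
    refine ⟨MvPolynomial.homogeneousComponent d.toNat P, ?_, ?_⟩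
    · rw [SetLike.mem_coe, MvPolynomial.mem_restrictTotalDegree]
      exact (MvPolynomial.homogeneousComponent_isHomogeneous _ _).totalDegree_le
    · funext W
      rw [hP W]; exact ((haux W).2 hd0).symm
  exact Submodule.finiteDimensional_of_le key

lemma circ_ne_zero_of_mem (Q : FinQuiver) (α β : Q.V → ℕ) (ht : Q.V → ℕ)
    (hh : ∀ a, ht (Q.t a) = ht (Q.h a) + 1) (f : Q.Rep β → ℂ)
    (hf : f ∈ Q.SIw β (Q.weightOf α)) (W : Q.Rep β) (hW : f W ≠ 0) : Q.circ α β ≠ 0 := by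
  have := Q.SIw_finite β (Q.weightOf α) ht hh
  have : Nontrivial (Q.SIw β (Q.weightOf α)) := by
    refine ⟨⟨⟨f, hf⟩, 0, fun h => hW ?_⟩⟩
    have := congrArg Subtype.val h
    simpa using congrFun this W
  exact (Module.finrank_pos (R := ℂ) (M := Q.SIw β (Q.weightOf α))).ne'

lemma one_mem_SIw (Q : FinQuiver) (β : Q.V → ℕ) (σ : Q.V → ℤ)
    (h : ∀ x, β x = 0 ∨ σ x = 0) : (fun _ => 1) ∈ Q.SIw β σ := by
  refine ⟨⟨1, fun W => by simp⟩, fun g W => ?_⟩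
  have : Q.detWeight σ g = 1 := by
    refine Finset.prod_eq_one fun x _ => ?_
    rcases h x with h | h
    · have : IsEmpty (Fin (β x)) := by rw [h]; infer_instance
      rw [Matrix.det_isEmpty, one_zpow]
    · rw [h, zpow_zero]
  simp [this]

end FinQuiver

/-- The vertex set of `𝒯` as an iterated sum. -/
def TVert.equivSum (m p n : ℕ) : TVert m p n ≃ Fin (m + p) ⊕ Unit ⊕ Unit ⊕ Fin n where
  toFun
    | .x l => Sum.inl l
    | .x0 => Sum.inr (Sum.inl ())
    | .y0 => Sum.inr (Sum.inr (Sum.inl ()))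
    | .y j => Sum.inr (Sum.inr (Sum.inr j))
  invFun
    | .inl l => .x l
    | .inr (.inl _) => .x0
    | .inr (.inr (.inl _)) => .y0
    | .inr (.inr (.inr j)) => .y j
  left_inv v := by cases v <;> rfl
  right_inv v := by rcases v with v | v | v | v <;> rfl

lemma TVert.sum_eq {m p n : ℕ} (f : TVert m p n → ℤ) :
    ∑ v, f v = ∑ l, f (.x l) + (f .x0 + (f .y0 + ∑ j, f (.y j))) := by
  rw [← (TVert.equivSum m p n).symm.sum_comp f]
  simp [Fintype.sum_sum_type, TVert.equivSum]

lemma TVert.prod_eq {m p n : ℕ} (f : TVert m p n → ℂ) :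
    ∏ v, f v = (∏ l, f (.x l)) * (f .x0 * (f .y0 * ∏ j, f (.y j))) := by
  rw [← (TVert.equivSum m p n).symm.prod_comp f]
  simp [Fintype.prod_sum_type, TVert.equivSum]

lemma Tquiv_euler {m p n : ℕ} (α γ : TVert m p n → ℤ) :
    (Tquiv m p n).euler α γ =
      (∑ l, α (.x l) * γ (.x l) + (α .x0 * γ .x0 + (α .y0 * γ .y0 + ∑ j, α (.y j) * γ (.y j))))
      - (∑ l, α (.x l) * γ .x0 + (α .x0 * γ .y0 + ∑ j, α .y0 * γ (.y j))) := by
  have h1 := TVert.sum_eq (fun v => α v * γ v)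
  have h2 : ∑ a : Fin (m + p) ⊕ Unit ⊕ Fin n, α ((Tquiv m p n).t a) * γ ((Tquiv m p n).h a)
      = ∑ l, α (.x l) * γ .x0 + (α .x0 * γ .y0 + ∑ j, α .y0 * γ (.y j)) := by
    simp [Fintype.sum_sum_type, Tquiv]
  exact congrArg₂ (· - ·) h1 h2

lemma euler_delta_delta {m p n : ℕ} (i i' : Fin m) :
    (Tquiv m p n).euler (natToInt (deltaT m p n i)) (natToInt (deltaT m p n i'))
      = if i = i' then 1 else 0 := by
  refine (Tquiv_euler _ _).trans ?_
  have h1 : ∀ l : Fin m, ¬ (m ≤ l.val) := fun l => by omega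
  simp only [natToInt, deltaT, Fin.sum_univ_add, Fin.val_castAdd, Fin.val_natAdd, h1, or_false,
    Fin.val_inj]
  simp only [eq_comm (a := i) (b := i')]
  simp
  split_ifs <;> ring

lemma euler_ey_ey {m p n : ℕ} (j j' : Fin n) :
    (Tquiv m p n).euler (natToInt (eyT m p n j)) (natToInt (eyT m p n j'))
      = if j = j' then 1 else 0 := by
  refine (Tquiv_euler _ _).trans ?_
  simp [natToInt, eyT, eq_comm (a := j) (b := j')]

lemma euler_ey_delta {m p n : ℕ} (j : Fin n) (i : Fin m) :
    (Tquiv m p n).euler (natToInt (eyT m p n j)) (natToInt (deltaT m p n i)) = 0 := by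
  refine (Tquiv_euler _ _).trans ?_
  simp [natToInt, eyT, deltaT]

lemma euler_delta_ey {m p n : ℕ} (i : Fin m) (j : Fin n) :
    (Tquiv m p n).euler (natToInt (deltaT m p n i)) (natToInt (eyT m p n j)) = -(p : ℤ) := by
  refine (Tquiv_euler _ _).trans ?_
  simp [natToInt, eyT, deltaT]

lemma seqE_castAdd {m p n : ℕ} (i : Fin m) : seqE m p n (Fin.castAdd n i) = deltaT m p n i := by
  simp [seqE]

lemma seqE_natAdd {m p n : ℕ} (j : Fin n) : seqE m p n (Fin.natAdd m j) = eyT m p n j := by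
  simp [seqE]

/-- The height function on the vertices of `𝒯`. -/
def TVert.ht {m p n : ℕ} : TVert m p n → ℕ
  | .x _ => 3
  | .x0 => 2
  | .y0 => 1
  | .y _ => 0

lemma TVert.ht_spec {m p n : ℕ} (a : (Tquiv m p n).A) :
    TVert.ht ((Tquiv m p n).t a) = TVert.ht ((Tquiv m p n).h a) + 1 := by
  rcases a with a | a | a <;> rfl

lemma Tquiv_weightOf {m p n : ℕ} (α : TVert m p n → ℕ) (v : TVert m p n) :
    (Tquiv m p n).weightOf α v = (α v : ℤ) -
      (∑ l, (if TVert.x0 = v then (α (.x l) : ℤ) else 0) +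
      ((if TVert.y0 = v then (α .x0 : ℤ) else 0) +
      ∑ j, (if TVert.y j = v then (α .y0 : ℤ) else 0))) := by
  refine congrArg (fun z => (α v : ℤ) - z) ?_
  refine (Fintype.sum_sum_type _).trans (congrArg₂ (· + ·) rfl ?_)
  exact (Fintype.sum_sum_type _).trans (congrArg₂ (· + ·) (Fintype.sum_unique _) rfl)

/-- Index of the basis vector at `x₀` attached to a source vertex. -/
def idxT (m p : ℕ) (l : Fin (m + p)) : Fin (p + 1) :=
  if h : m ≤ l.val then ⟨l.val - m + 1, by have := l.isLt; omega⟩ else 0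

/-- The Schur representation of dimension vector `δᵢ`. -/
def schurRep (m p n : ℕ) (i : Fin m) : (Tquiv m p n).Rep (deltaT m p n i) := fun a =>
  match a with
  | .inl l => fun (r : Fin (p + 1)) _ => if r = idxT m p l then 1 else 0
  | .inr (.inl _) => fun (r : Fin p) (s : Fin (p + 1)) =>
      if s = 0 then 1 else if s = r.succ then 1 else 0
  | .inr (.inr _) => fun (r : Fin 0) _ => r.elim0

lemma schurRep_isSchur (m p n : ℕ) (i : Fin m) : (Tquiv m p n).IsSchur (schurRep m p n i) := by
  have h1mem : (fun x => (1 : Matrix (Fin (deltaT m p n i x)) (Fin (deltaT m p n i x)) ℂ)) ∈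
      (Tquiv m p n).homSpace (schurRep m p n i) (schurRep m p n i) := by
    intro a
    show 1 * _ = _ * 1
    rw [Matrix.one_mul, Matrix.mul_one]
  refine (finrank_eq_one_iff_of_nonzero' ⟨_, h1mem⟩ ?_).mpr ?_
  · intro h
    have h2 := congrFun (congrArg Subtype.val h) TVert.x0
    have h3 := congrFun (congrFun h2 (0 : Fin (p + 1))) (0 : Fin (p + 1))
    exact one_ne_zero (α := ℂ) h3
  · rintro ⟨φ, hφ⟩
    let X : Matrix (Fin (p + 1)) (Fin (p + 1)) ℂ := φ TVert.x0
    let Y : Matrix (Fin p) (Fin p) ℂ := φ TVert.y0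
    let A : Matrix (Fin p) (Fin (p + 1)) ℂ := fun (r : Fin p) (s : Fin (p + 1)) =>
      if s = 0 then 1 else if s = r.succ then 1 else 0
    -- the arrows from the sources
    have hx : ∀ (l : Fin (m + p)) (c : Fin (deltaT m p n i (.x l))) (r : Fin (p + 1)),
        X r (idxT m p l) = if r = idxT m p l then φ (.x l) c c else 0 := by
      intro l c r
      have h := congrFun (congrFun (hφ (.inl l)) r) c
      have hss : Subsingleton (Fin (deltaT m p n i (.x l))) := by
        simp only [deltaT]; split_ifs <;> infer_instance
      have hl : (∑ s : Fin (p + 1), X r s * (if s = idxT m p l then 1 else 0))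
        = ∑ c' : Fin (deltaT m p n i (.x l)),
          (if r = idxT m p l then (1 : ℂ) else 0) * φ (.x l) c' c := h
      rw [Fintype.sum_subsingleton _ c] at hl
      simpa using hl
    have hA : Y * A = A * X := hφ (.inr (.inl ()))
    have hci : 0 < deltaT m p n i (.x (Fin.castAdd p i)) := by simp [deltaT]
    have hck : ∀ k : Fin p, 0 < deltaT m p n i (.x (Fin.natAdd m k)) := by
      intro k; simp [deltaT]
    have hidx0 : idxT m p (Fin.castAdd p i) = 0 := by simp [idxT]
    have hidxk : ∀ k : Fin p, idxT m p (Fin.natAdd m k) = k.succ := by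
      intro k; ext; simp [idxT]
    have hoff : ∀ r s, r ≠ s → X r s = 0 := by
      intro r s hrs
      refine Fin.cases (fun hrs => ?_) (fun k hrs => ?_) s hrs
      · have := hx (Fin.castAdd p i) ⟨0, hci⟩ r
        rw [hidx0, if_neg hrs] at this; exact this
      · have := hx (Fin.natAdd m k) ⟨0, hck k⟩ r
        rw [hidxk, if_neg hrs] at this; exact this
    have hAX : ∀ r s, (A * X) r s = A r s * X s s := by
      intro r s
      rw [Matrix.mul_apply]
      refine Finset.sum_eq_single s (fun b _ hb => by rw [hoff b s hb, mul_zero]) (by simp)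
    have hYk : ∀ r k : Fin p, Y r k = if k = r then X k.succ k.succ else 0 := by
      intro r k
      have h := congrFun (congrFun hA r) k.succ
      rw [hAX, Matrix.mul_apply] at h
      simpa [A] using h
    have hX0 : ∀ k : Fin p, X k.succ k.succ = X 0 0 := by
      intro k
      have h := congrFun (congrFun hA k) 0
      rw [hAX, Matrix.mul_apply] at h
      simpa [A, hYk] using h
    have hXd : ∀ s, X s s = X 0 0 := fun s => Fin.cases rfl hX0 s
    refine ⟨X 0 0, ?_⟩
    apply Subtype.ext
    funext v
    show X 0 0 • (1 : Matrix (Fin (deltaT m p n i v)) (Fin (deltaT m p n i v)) ℂ) = φ v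
    cases v with
    | x l =>
      ext c c'
      have hss : Subsingleton (Fin (deltaT m p n i (.x l))) := by
        simp only [deltaT]; split_ifs <;> infer_instance
      obtain rfl : c = c' := Subsingleton.elim _ _
      have := hx l c (idxT m p l)
      rw [if_pos rfl, hXd] at this
      simp [this]
    | x0 =>
      show X 0 0 • (1 : Matrix (Fin (p + 1)) (Fin (p + 1)) ℂ) = X
      ext r s
      by_cases h : r = s
      · subst h; simp [hXd r]
      · simp [h, hoff r s h]
    | y0 =>
      show X 0 0 • (1 : Matrix (Fin p) (Fin p) ℂ) = Y
      ext r s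
      by_cases h : r = s
      · subst h; simp [hYk, hX0]
      · simp [h, hYk, Ne.symm h]
    | y j => ext c; exact c.elim0

lemma exists_schur_ey (m p n : ℕ) (j : Fin n) :
    ∃ V : (Tquiv m p n).Rep (eyT m p n j), (Tquiv m p n).IsSchur V := by
  refine ⟨fun _ => 0, ?_⟩
  have hmem : ∀ φ, φ ∈ (Tquiv m p n).homSpace (α := eyT m p n j) (γ := eyT m p n j)
      (fun _ => 0) (fun _ => 0) := by
    intro φ a
    show _ * 0 = 0 * _
    rw [Matrix.mul_zero, Matrix.zero_mul]
  have hj : 0 < eyT m p n j (.y j) := by simp [eyT]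
  refine (finrank_eq_one_iff_of_nonzero' ⟨fun _ => 1, hmem _⟩ ?_).mpr ?_
  · intro h
    have h2 := congrFun (congrArg Subtype.val h) (TVert.y j)
    have h3 := congrFun (congrFun h2 ⟨0, hj⟩) ⟨0, hj⟩
    have h4 : (1 : Matrix (Fin (eyT m p n j (.y j))) (Fin (eyT m p n j (.y j))) ℂ)
      ⟨0, hj⟩ ⟨0, hj⟩ = 0 := h3
    rw [Matrix.one_apply_eq] at h4
    exact one_ne_zero h4
  · rintro ⟨φ, hφ⟩
    refine ⟨φ (.y j) ⟨0, hj⟩ ⟨0, hj⟩, ?_⟩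
    apply Subtype.ext
    funext v
    show φ (.y j) ⟨0, hj⟩ ⟨0, hj⟩ •
      (1 : Matrix (Fin (eyT m p n j v)) (Fin (eyT m p n j v)) ℂ) = φ v
    by_cases hv : v = .y j
    · subst hv
      ext c c'
      have hss : Subsingleton (Fin (eyT m p n j (.y j))) := by
        simp only [eyT, if_true]; infer_instance
      obtain rfl : c = c' := Subsingleton.elim _ _
      obtain rfl : c = ⟨0, hj⟩ := Subsingleton.elim _ _
      simp
    · have h0 : eyT m p n j v = 0 := by
        cases v with
        | y j' =>
          have : j' ≠ j := fun h => hv (by rw [h])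
          simp [eyT, this]
        | _ => rfl
      ext c
      rw [h0] at c
      exact c.elim0

lemma weightOf_ey {m p n : ℕ} (j : Fin n) (v : TVert m p n) :
    (Tquiv m p n).weightOf (eyT m p n j) v = (eyT m p n j v : ℤ) := by
  refine (Tquiv_weightOf _ _).trans ?_
  simp [eyT]

lemma circ_ey {m p n : ℕ} (j : Fin n) (β : TVert m p n → ℕ) (hβ : β (.y j) = 0) :
    (Tquiv m p n).circ (eyT m p n j) β ≠ 0 := by
  refine (Tquiv m p n).circ_ne_zero_of_mem _ _ TVert.ht TVert.ht_spec (fun _ => 1)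
    ((Tquiv m p n).one_mem_SIw _ _ ?_) (fun _ => 0) one_ne_zero
  intro v
  refine Or.imp_right (fun h => (weightOf_ey j v).trans h) ?_
  cases v with
  | y j' =>
    by_cases h : j' = j
    · left; rw [h]; exact hβ
    · right; simp [eyT, h]
  | _ => right; rfl

/-- The unique index of the one-dimensional space at `x_{m+k}`. -/
def cT (m p n : ℕ) (i : Fin m) (k : Fin p) : Fin (deltaT m p n i (.x (Fin.natAdd m k))) :=
  ⟨0, by simp [deltaT]⟩

/-- The `p × p` matrix whose determinant is the semi-invariant. -/
noncomputable def matT {m p n : ℕ} {i : Fin m} (W : (Tquiv m p n).Rep (deltaT m p n i)) :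
    Matrix (Fin p) (Fin p) ℂ := fun r k =>
  ∑ s : Fin (p + 1), W (.inr (.inl ())) r s * W (.inl (Fin.natAdd m k)) s (cT m p n i k)

lemma matT_schur {m p n : ℕ} (i : Fin m) : matT (schurRep m p n i) = 1 := by
  have hidxk : ∀ k : Fin p, idxT m p (Fin.natAdd m k) = k.succ := by
    intro k; ext; simp [idxT]
  ext r k
  show ∑ s : Fin (p + 1), (if s = 0 then (1 : ℂ) else if s = r.succ then 1 else 0) *
    (if s = idxT m p (Fin.natAdd m k) then 1 else 0) = _
  simp [hidxk, Matrix.one_apply, eq_comm]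

lemma matT_act {m p n : ℕ} {i : Fin m} (g : (Tquiv m p n).GLb (deltaT m p n i))
    (W : (Tquiv m p n).Rep (deltaT m p n i)) :
    matT ((Tquiv m p n).invAct g W) =
      (show (Matrix (Fin p) (Fin p) ℂ)ˣ from g TVert.y0)⁻¹.val * matT W *
      Matrix.diagonal (fun k => (g (.x (Fin.natAdd m k))).val (cT m p n i k) (cT m p n i k)) := by
  let G0 : (Matrix (Fin (p + 1)) (Fin (p + 1)) ℂ)ˣ := g TVert.x0
  let G1 : (Matrix (Fin p) (Fin p) ℂ)ˣ := g TVert.y0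
  let A : Matrix (Fin p) (Fin (p + 1)) ℂ := W (.inr (.inl ()))
  let B : Matrix (Fin (p + 1)) (Fin p) ℂ := fun s k => W (.inl (Fin.natAdd m k)) s (cT m p n i k)
  let D : Matrix (Fin p) (Fin p) ℂ :=
    Matrix.diagonal (fun k => (g (.x (Fin.natAdd m k))).val (cT m p n i k) (cT m p n i k))
  have hM : matT W = A * B := rfl
  let B' : Matrix (Fin (p + 1)) (Fin p) ℂ := fun s k =>
    (Tquiv m p n).invAct g W (.inl (Fin.natAdd m k)) s (cT m p n i k)
  have hB : B' = G0⁻¹.val * B * D := by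
    ext s k
    have hss : Subsingleton (Fin (deltaT m p n i (.x (Fin.natAdd m k)))) := by
      simp only [deltaT]; split_ifs <;> infer_instance
    rw [Matrix.mul_diagonal]
    let w : Matrix (Fin (p + 1)) (Fin (deltaT m p n i (.x (Fin.natAdd m k)))) ℂ :=
      W (.inl (Fin.natAdd m k))
    show ∑ c : Fin (deltaT m p n i (.x (Fin.natAdd m k))), (G0⁻¹.val * w) s c *
        (g (.x (Fin.natAdd m k))).val c (cT m p n i k) = _
    rw [Fintype.sum_subsingleton _ (cT m p n i k)]
    rfl
  have hM2 : matT ((Tquiv m p n).invAct g W) = (G1⁻¹.val * A * G0.val) * B' := rfl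
  rw [hM2, hB, hM]
  show _ = G1⁻¹.val * (A * B) * D
  have : G0.val * G0⁻¹.val = 1 := Units.mul_inv G0
  calc _ = G1⁻¹.val * A * (G0.val * G0⁻¹.val) * B * D := by simp only [Matrix.mul_assoc]
    _ = _ := by rw [this, Matrix.mul_one]; simp only [Matrix.mul_assoc]

lemma det_poly_aux {ι : Type} {p q : ℕ} (u : Fin p → Fin q → ι) (v : Fin q → Fin p → ι)
    (w : ι → ℂ) :
    Matrix.det (Matrix.of fun r k : Fin p => ∑ s : Fin q, w (u r s) * w (v s k)) =
    MvPolynomial.eval w (Matrix.det (Matrix.of fun r k : Fin p => ∑ s : Fin q,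
      (MvPolynomial.X (u r s) * MvPolynomial.X (v s k) : MvPolynomial ι ℂ))) := by
  rw [RingHom.map_det]
  refine congrArg Matrix.det ?_
  ext r k
  simp [Matrix.map_apply]

lemma detT_poly {m p n : ℕ} (i : Fin m) :
    (Tquiv m p n).IsPolyFun (β := deltaT m p n i) (fun W => (matT W).det) := by
  let ι : Type := (a : (Tquiv m p n).A) ×
      (Fin (deltaT m p n i ((Tquiv m p n).h a)) × Fin (deltaT m p n i ((Tquiv m p n).t a)))
  let u : Fin p → Fin (p + 1) → ι := fun r s => ⟨.inr (.inl ()), r, s⟩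
  let v : Fin (p + 1) → Fin p → ι := fun s k => ⟨.inl (Fin.natAdd m k), s, cT m p n i k⟩
  exact ⟨_, fun W => det_poly_aux u v (fun i => W i.1 i.2.1 i.2.2)⟩

lemma weightOf_delta {m p n : ℕ} (j : Fin m) (v : TVert m p n) :
    (Tquiv m p n).weightOf (deltaT m p n j) v =
      match v with
      | .x l => (deltaT m p n j (.x l) : ℤ)
      | .x0 => 0
      | .y0 => -1
      | .y _ => -p := by
  have h1 : ∀ l : Fin m, ¬ (m ≤ l.val) := fun l => by omega
  refine (Tquiv_weightOf _ _).trans ?_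
  have h2 : ∑ l, (deltaT m p n j (.x l) : ℤ) = p + 1 := by
    simp only [deltaT, Fin.sum_univ_add, Fin.val_castAdd, Fin.val_natAdd, h1, or_false,
      Fin.val_inj]
    simp
    ring
  cases v with
  | x0 => simp [h2]; simp [deltaT]
  | _ => simp [deltaT]

lemma circ_delta_delta {m p n : ℕ} (i j : Fin m) (hij : i ≠ j) :
    (Tquiv m p n).circ (deltaT m p n j) (deltaT m p n i) ≠ 0 := by
  refine (Tquiv m p n).circ_ne_zero_of_mem _ _ TVert.ht TVert.ht_spec (fun W => (matT W).det)
    ⟨detT_poly i, fun g W => ?_⟩ (schurRep m p n i) (by simp [matT_schur])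
  have hdw : (Tquiv m p n).detWeight ((Tquiv m p n).weightOf (deltaT m p n j)) g =
      (∏ k : Fin p, (g (.x (Fin.natAdd m k))).val (cT m p n i k) (cT m p n i k)) *
        ((g TVert.y0).val.det)⁻¹ := by
    refine (TVert.prod_eq (fun v => (g v).val.det ^
      (Tquiv m p n).weightOf (deltaT m p n j) v)).trans ?_
    rw [Fin.prod_univ_add]
    simp only [weightOf_delta, zpow_zero, one_mul, zpow_neg, zpow_one]
    have e1 : ∏ l : Fin m, (g (.x (Fin.castAdd p l))).val.det ^
        (deltaT m p n j (.x (Fin.castAdd p l)) : ℤ) = 1 := by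
      refine Finset.prod_eq_one fun l _ => ?_
      by_cases hl : l = j
      · have h0 : deltaT m p n i (.x (Fin.castAdd p l)) = 0 := by
          subst hl
          have : l.val ≠ i.val := fun h => hij (Fin.ext h.symm)
          have := l.isLt
          simp [deltaT]; omega
        have : IsEmpty (Fin (deltaT m p n i (.x (Fin.castAdd p l)))) := by
          rw [h0]; infer_instance
        have hd : (g (.x (Fin.castAdd p l))).val.det = 1 := Matrix.det_isEmpty
        rw [hd, one_zpow]
      · have h0 : deltaT m p n j (.x (Fin.castAdd p l)) = 0 := by
          have : l.val ≠ j.val := fun h => hl (Fin.ext h)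
          have := l.isLt
          simp [deltaT]; omega
        rw [h0]; simp
    have e2 : ∀ k : Fin p, (g (.x (Fin.natAdd m k))).val.det ^
        (deltaT m p n j (.x (Fin.natAdd m k)) : ℤ) =
        (g (.x (Fin.natAdd m k))).val (cT m p n i k) (cT m p n i k) := by
      intro k
      have h0 : deltaT m p n j (.x (Fin.natAdd m k)) = 1 := by simp [deltaT]
      have hss : Subsingleton (Fin (deltaT m p n i (.x (Fin.natAdd m k)))) := by
        simp only [deltaT]; split_ifs <;> infer_instance
      rw [h0, Nat.cast_one, zpow_one]
      exact Matrix.det_eq_elem_of_subsingleton _ _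
    have e3 : ∀ l : Fin n, (g (.y l)).val.det = 1 := by
      intro l
      have : IsEmpty (Fin (deltaT m p n i (.y l))) := Fin.isEmpty
      exact Matrix.det_isEmpty
    rw [e1, one_mul, Finset.prod_congr rfl (fun k _ => e2 k)]
    congr 1
    conv_rhs => rw [← mul_one ((g TVert.y0).val.det)⁻¹]
    congr 1
    refine Finset.prod_eq_one fun l _ => ?_
    rw [e3 l]; simp
  rw [hdw]
  show (matT ((Tquiv m p n).invAct g W)).det = _ * (matT W).det
  rw [matT_act, Matrix.det_mul, Matrix.det_mul, Matrix.det_diagonal]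
  have hdet : (show (Matrix (Fin p) (Fin p) ℂ)ˣ from g TVert.y0)⁻¹.val.det =
      ((g TVert.y0).val.det)⁻¹ := by
    let G1 : (Matrix (Fin p) (Fin p) ℂ)ˣ := g TVert.y0
    show G1⁻¹.val.det = (G1.val.det)⁻¹
    rw [Matrix.coe_units_inv, Matrix.det_nonsing_inv, Ring.inverse_eq_inv']
  rw [hdet]
  ring

lemma seqE_isExcSeq (m n p : ℕ) : (Tquiv m p n).IsExcSeq (seqE m p n) := by
  refine ⟨fun i => ?_, fun i j => ?_⟩
  · refine Fin.addCases (fun i => ?_) (fun j => ?_) i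
    · rw [seqE_castAdd]
      exact ⟨by rw [euler_delta_delta, if_pos rfl], _, schurRep_isSchur m p n i⟩
    · rw [seqE_natAdd]
      exact ⟨by rw [euler_ey_ey, if_pos rfl], exists_schur_ey m p n j⟩
  · refine Fin.addCases (fun i => ?_) (fun i => ?_) i <;>
    refine Fin.addCases (fun j => ?_) (fun j => ?_) j <;> intro hij
    · rw [seqE_castAdd, seqE_castAdd]
      have hne : i ≠ j := by rintro rfl; exact lt_irrefl _ hij
      exact ⟨by rw [euler_delta_delta, if_neg hne], circ_delta_delta i j hne⟩
    · rw [seqE_castAdd, seqE_natAdd]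
      exact ⟨by rw [euler_delta_ey]; omega, circ_ey j _ rfl⟩
    · exfalso
      have h := Fin.lt_def.mp hij
      simp at h
      omega
    · rw [seqE_natAdd, seqE_natAdd]
      have hne : i ≠ j := by rintro rfl; exact lt_irrefl _ hij
      exact ⟨by rw [euler_ey_ey, if_neg hne], circ_ey j _ (by simp [eyT, hne.symm])⟩

/-- Number of arrows of the quiver of the sequence. -/
lemma card_arrows (m n p : ℕ) (i : Fin m) (j : Fin n) :
    (if (Fin.castAdd n i) = (Fin.natAdd m j) then 0 else
      (-((Tquiv m p n).euler (natToInt (seqE m p n (Fin.castAdd n i)))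
        (natToInt (seqE m p n (Fin.natAdd m j))))).toNat) = p := by
  have : Fin.castAdd n i ≠ Fin.natAdd m j := by
    intro h
    have := congrArg Fin.val h
    simp at this; omega
  rw [if_neg this, seqE_castAdd, seqE_natAdd, euler_delta_ey]
  simp

lemma TE_iso (m n p : ℕ) :
    Nonempty (QuiverIso ((Tquiv m p n).quiverOfSeq (seqE m p n)) (Qpmn m n p)) := by
  let F : (Qpmn m n p).A → ((Tquiv m p n).quiverOfSeq (seqE m p n)).A := fun a =>
    ⟨Fin.castAdd n a.1, Fin.natAdd m a.2.1, Fin.cast (card_arrows m n p a.1 a.2.1).symm a.2.2⟩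
  have hz : ∀ a b : Fin (m + n), (a ≠ b → (Tquiv m p n).euler (natToInt (seqE m p n a))
      (natToInt (seqE m p n b)) = 0) → (if a = b then 0 else
      (-((Tquiv m p n).euler (natToInt (seqE m p n a)) (natToInt (seqE m p n b)))).toNat) = 0 := by
    intro a b h
    by_cases hab : a = b
    · rw [if_pos hab]
    · rw [if_neg hab, h hab]; rfl
  have hF : Function.Bijective F := by
    constructor
    · rintro ⟨i, j, k⟩ ⟨i', j', k'⟩ h
      have h1 : Fin.castAdd n i = Fin.castAdd n i' := congrArg (fun a => a.1) h
      have h2 : Fin.natAdd m j = Fin.natAdd m j' := congrArg (fun a => a.2.1) h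
      have h3 : k.val = k'.val := congrArg (fun a => a.2.2.val) h
      obtain rfl := Fin.castAdd_injective _ _ h1
      obtain rfl := (Fin.natAdd_injective _ _) h2
      obtain rfl := Fin.ext h3
      rfl
    · rintro ⟨i, j, k⟩
      revert k
      refine Fin.addCases (fun i => ?_) (fun i => ?_) i <;>
      refine Fin.addCases (fun j => ?_) (fun j => ?_) j <;> intro k
      · exact ((Fin.cast (hz _ _ (fun h => by
          have hne : i ≠ j := fun e => h (by rw [e])
          rw [seqE_castAdd, seqE_castAdd, euler_delta_delta, if_neg hne])) k) : Fin 0).elim0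
      · exact ⟨(i, j, Fin.cast (card_arrows m n p i j) k), rfl⟩
      · exact ((Fin.cast (hz _ _ (fun h => by
          rw [seqE_castAdd, seqE_natAdd, euler_ey_delta])) k) : Fin 0).elim0
      · exact ((Fin.cast (hz _ _ (fun h => by
          have hne : i ≠ j := fun e => h (by rw [e])
          rw [seqE_natAdd, seqE_natAdd, euler_ey_ey, if_neg hne])) k) : Fin 0).elim0
  let E := (Equiv.ofBijective F hF).symm
  have hE : ∀ a, F (E a) = a := fun a => (Equiv.ofBijective F hF).apply_symm_apply a
  refine ⟨⟨finSumFinEquiv.symm, E, fun a => ?_, fun a => ?_⟩⟩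
  · show Sum.inl (E a).1 = finSumFinEquiv.symm a.1
    conv_rhs => rw [← hE a]
    exact (finSumFinEquiv_symm_apply_castAdd _).symm
  · show Sum.inr (E a).2.1 = finSumFinEquiv.symm a.2.1
    conv_rhs => rw [← hE a]
    exact (finSumFinEquiv_symm_apply_natAdd _).symm

/-- The sequence `ℰ = (δ₁,…,δ_m, e_{y₁},…,e_{y_n})` is a quiver
exceptional sequence for `𝒯`, the associated quiver `𝒯(ℰ)` is isomorphic to the
`p`-complete bipartite quiver `Q^p_{m,n}`, and the Euler form takes the stated values on
the members of `ℰ`. -/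
theorem seqE_is_exceptional_and_TE_iso_Qpmn
    (m n p : ℕ) (hm : 0 < m) (hn : 0 < n) (hp : 0 < p) :
    (Tquiv m p n).IsExcSeq (seqE m p n) ∧
    Nonempty (QuiverIso ((Tquiv m p n).quiverOfSeq (seqE m p n)) (Qpmn m n p)) ∧
    (∀ i : Fin m,
      (Tquiv m p n).euler (natToInt (deltaT m p n i)) (natToInt (deltaT m p n i)) = 1) ∧
    (∀ j : Fin n,
      (Tquiv m p n).euler (natToInt (eyT m p n j)) (natToInt (eyT m p n j)) = 1) ∧
    (∀ i i' : Fin m, i ≠ i' →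
      (Tquiv m p n).euler (natToInt (deltaT m p n i)) (natToInt (deltaT m p n i')) = 0) ∧
    (∀ j j' : Fin n, j ≠ j' →
      (Tquiv m p n).euler (natToInt (eyT m p n j)) (natToInt (eyT m p n j')) = 0) ∧
    (∀ j : Fin n, ∀ i : Fin m,
      (Tquiv m p n).euler (natToInt (eyT m p n j)) (natToInt (deltaT m p n i)) = 0) ∧
    (∀ i : Fin m, ∀ j : Fin n,
      (Tquiv m p n).euler (natToInt (deltaT m p n i)) (natToInt (eyT m p n j)) = -(p : ℤ)) := by
  exact ⟨seqE_isExcSeq m n p, TE_iso m n p,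
    fun i => by rw [euler_delta_delta, if_pos rfl],
    fun j => by rw [euler_ey_ey, if_pos rfl],
    fun i i' h => by rw [euler_delta_delta, if_neg h],
    fun j j' h => by rw [euler_ey_ey, if_neg h],
    fun j i => euler_ey_delta j i, fun i j => euler_delta_ey i j⟩
end
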